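/- arXiv:2510.22186 — 4 statements merged into one kernel-verified Lean document; each statement's English description precedes it below -/
import Mathlib

section
/- Let d, n, D be natural numbers satisfying D ≥ 18·d·n²·log( (48√3·n·√(d + 3·log(√6·n)))/√π + 1 ). Let A ∈ ℝ^{d×D} be a random matrix whose columns are drawn independently from the uniform (rotation-invariant) probability distribution on the unit sphere S^{d−1} ⊂ ℝ^d. Then with probability at least 1 − exp(−D/(18n²)), it holds that for all X, Y ∈ ℝ^{n×d}, ‖β_A(X) − β_A(Y)‖_F ≥ (√π/(24√3)) · (d + 3·log(√6·n))^{−1/2} · (√D/n²) · dist(X,Y). -/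
open Matrix MeasureTheory

/-- `sortVec v` rearranges the entries of `v` in non-decreasing order. -/
noncomputable def sortVec {n : ℕ} (v : Fin n → ℝ) : Fin n → ℝ := v ∘ Tuple.sort v

/-- The sorting-based embedding `β_A`: the `k`-th column of `β_A X` is `sort (X a_k)`,
where `a_k` is the `k`-th column of `A`. -/
noncomputable def betaEmb {n d D : ℕ} (A : Matrix (Fin d) (Fin D) ℝ)
    (X : Matrix (Fin n) (Fin d) ℝ) : Matrix (Fin n) (Fin D) ℝ :=
  Matrix.of fun i k => sortVec (X.mulVec fun l => A l k) i

/-- Frobenius norm of a real matrix. -/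
noncomputable def frob {n m : ℕ} (M : Matrix (Fin n) (Fin m) ℝ) : ℝ :=
  Real.sqrt (∑ i, ∑ j, (M i j) ^ 2)

/-- `dist(X,Y) = min_{σ ∈ S_n} ‖X - σY‖_F`, where `σ` acts by permuting rows. -/
noncomputable def permDist {n d : ℕ} (X Y : Matrix (Fin n) (Fin d) ℝ) : ℝ :=
  ⨅ σ : Equiv.Perm (Fin n), frob (X - Y.submatrix σ id)

theorem exists_orthogonal_dotProduct_eq {d : ℕ} (w w' : Fin d → ℝ) (h : w ⬝ᵥ w = w' ⬝ᵥ w') :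
    ∃ Q : Matrix (Fin d) (Fin d) ℝ, Q * Qᵀ = 1 ∧ ∀ a, (Q *ᵥ a) ⬝ᵥ w = a ⬝ᵥ w' := by
  by_cases hv : (w - w') ⬝ᵥ (w - w') = 0
  · have hw : w = w' := sub_eq_zero.mp (dotProduct_self_eq_zero.mp hv)
    exact ⟨1, by simp, fun a => by simp [hw]⟩
  · set v := w - w' with hvdef
    have hvw : 2 * (v ⬝ᵥ w) = v ⬝ᵥ v := by
      simp only [hvdef, sub_dotProduct, dotProduct_sub, dotProduct_comm w' w]
      linarith
    refine ⟨1 - (2 / (v ⬝ᵥ v)) • vecMulVec v v, ?_, fun a => ?_⟩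
    · have hcc : (2 / (v ⬝ᵥ v)) * (2 / (v ⬝ᵥ v)) * (v ⬝ᵥ v) = 2 * (2 / (v ⬝ᵥ v)) := by
        field_simp
      have hsq : vecMulVec v v * vecMulVec v v = (v ⬝ᵥ v) • vecMulVec v v := by
        rw [vecMulVec_mul_vecMulVec, vecMulVec_smul]
      rw [transpose_sub, transpose_one, transpose_smul, transpose_vecMulVec]
      simp only [sub_mul, mul_sub, Matrix.smul_mul, Matrix.mul_smul, hsq, one_mul, mul_one,
        smul_smul]
      rw [← mul_assoc, hcc, two_mul, add_smul]
      abel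
    · rw [sub_mulVec, one_mulVec, smul_mulVec, vecMulVec_mulVec, sub_dotProduct, smul_dotProduct]
      have : a ⬝ᵥ w' = a ⬝ᵥ w - v ⬝ᵥ a := by
        rw [hvdef, sub_dotProduct, dotProduct_comm w, dotProduct_comm w']; ring
      rw [this]
      simp only [op_smul_eq_smul, smul_dotProduct, smul_eq_mul, ← hvw]
      have : v ⬝ᵥ w ≠ 0 := by intro h0; rw [h0] at hvw; exact hv (by linarith)
      field_simp

theorem map_dotProduct_eq_of_rotation_invariant {d : ℕ} {μ : Measure (Fin d → ℝ)}
    (hinv : ∀ Q : Matrix (Fin d) (Fin d) ℝ, Q * Qᵀ = 1 → μ.map Q.mulVec = μ)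
    {w w' : Fin d → ℝ} (h : w ⬝ᵥ w = w' ⬝ᵥ w') (s : ℝ) :
    μ {a | |a ⬝ᵥ w| ≤ s} = μ {a | |a ⬝ᵥ w'| ≤ s} := by
  obtain ⟨Q, hQ, hQw⟩ := exists_orthogonal_dotProduct_eq w w' h
  have hm : MeasurableSet {a : Fin d → ℝ | |a ⬝ᵥ w| ≤ s} := by
    refine measurableSet_le ?_ measurable_const
    unfold dotProduct
    fun_prop
  conv_lhs => rw [← hinv Q hQ]
  rw [Measure.map_apply (by fun_prop) hm]
  simp [hQw]

open ProbabilityTheory in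
theorem stdGaussian_abs_inner_le {d : ℕ} (a : EuclideanSpace ℝ (Fin d)) (ha : ‖a‖ = 1) (τ : ℝ) :
    stdGaussian (EuclideanSpace ℝ (Fin d)) {g | |inner ℝ a g| ≤ τ} ≤
      ENNReal.ofReal (2 * τ / √(2 * Real.pi)) := by
  have hmap := IsGaussian.map_eq_gaussianReal (μ := stdGaussian (EuclideanSpace ℝ (Fin d)))
    (innerSL ℝ a)
  rw [integral_strongDual_stdGaussian, variance_dual_stdGaussian, innerSL_apply_norm, ha] at hmap
  have hset : {g : EuclideanSpace ℝ (Fin d) | |inner ℝ a g| ≤ τ} =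
      (innerSL ℝ a) ⁻¹' Set.Icc (-τ) τ := by
    ext g; simp [abs_le]
  rw [hset, ← Measure.map_apply (by fun_prop) measurableSet_Icc, hmap,
    gaussianReal_apply _ (by simp)]
  calc ∫⁻ x in Set.Icc (-τ) τ, gaussianPDF 0 (1 ^ 2 : ℝ).toNNReal x
      ≤ ∫⁻ _ in Set.Icc (-τ) τ, ENNReal.ofReal (1 / √(2 * Real.pi)) := by
        refine lintegral_mono fun x => ?_
        refine ENNReal.ofReal_le_ofReal ?_
        simp only [gaussianPDFReal, one_pow, Real.toNNReal_one, NNReal.coe_one, mul_one, sub_zero,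
          one_div]
        refine mul_le_of_le_one_right (by positivity) (Real.exp_le_one_iff.mpr ?_)
        have := sq_nonneg x
        linarith
    _ = ENNReal.ofReal (2 * τ / √(2 * Real.pi)) := by
        rw [lintegral_const, Measure.restrict_apply MeasurableSet.univ, Set.univ_inter,
          Real.volume_Icc, ← ENNReal.ofReal_mul (by positivity)]
        congr 1; ring

open ProbabilityTheory in
theorem stdGaussian_norm_sq_le {d : ℕ} (hd : 0 < d) :
    2⁻¹ ≤ stdGaussian (EuclideanSpace ℝ (Fin d)) {g | ‖g‖ ^ 2 ≤ 2 * d} := by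
  set G := stdGaussian (EuclideanSpace ℝ (Fin d))
  have hcoord (i : Fin d) : ∫⁻ g, ENNReal.ofReal (g i ^ 2) ∂G = 1 := by
    have hL : ∀ g : EuclideanSpace ℝ (Fin d),
        innerSL ℝ (EuclideanSpace.single i (1 : ℝ)) g = g i := fun g => by
      simp [EuclideanSpace.inner_single_left]
    have hvar := variance_dual_stdGaussian (innerSL ℝ (EuclideanSpace.single i (1 : ℝ)))
    have hmean := integral_strongDual_stdGaussian (innerSL ℝ (EuclideanSpace.single i (1 : ℝ)))
    have hmem : MemLp (innerSL ℝ (EuclideanSpace.single i (1 : ℝ))) 2 G :=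
      IsGaussian.memLp_dual G _ 2 (by simp)
    rw [variance_of_integral_eq_zero (by fun_prop) hmean] at hvar
    rw [← ofReal_integral_eq_lintegral_ofReal]
    · simp only [hL] at hvar
      rw [hvar]; simp
    · simpa [hL] using hmem.integrable_sq
    · exact Filter.Eventually.of_forall fun g => sq_nonneg _
  have hsum : ∫⁻ g, ENNReal.ofReal (‖g‖ ^ 2) ∂G = d := by
    simp_rw [EuclideanSpace.norm_sq_eq, Real.norm_eq_abs, sq_abs]
    simp_rw [ENNReal.ofReal_sum_of_nonneg (fun i _ => sq_nonneg _)]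
    rw [lintegral_finsetSum _ (by fun_prop)]
    simp [hcoord]
  have hmarkov := mul_meas_ge_le_lintegral (μ := G)
    (f := fun g => ENNReal.ofReal (‖g‖ ^ 2)) (by fun_prop) (2 * d)
  rw [hsum] at hmarkov
  have hd0 : (d : ENNReal) ≠ 0 := by exact_mod_cast hd.ne'
  have hhalf : G {g | (2 * d : ENNReal) ≤ ENNReal.ofReal (‖g‖ ^ 2)} ≤ 2⁻¹ := by
    have h2 : (d : ENNReal) * (2 * G {g | (2 * d : ENNReal) ≤ ENNReal.ofReal (‖g‖ ^ 2)}) ≤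
        d * 1 := by rw [mul_one]; refine le_trans (le_of_eq ?_) hmarkov; ring
    have h3 := (ENNReal.mul_le_mul_iff_right hd0 (by simp)).mp h2
    rw [ENNReal.le_inv_iff_mul_le, mul_comm]; exact h3
  have hmeas : MeasurableSet {g : EuclideanSpace ℝ (Fin d) | ‖g‖ ^ 2 ≤ 2 * d} :=
    measurableSet_le (by fun_prop) measurable_const
  have hcompl : G {g | ‖g‖ ^ 2 ≤ 2 * d}ᶜ ≤ 2⁻¹ := by
    refine (measure_mono fun g hg => ?_).trans hhalf
    have hg' : (2 * d : ℝ) ≤ ‖g‖ ^ 2 := by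
      simp only [Set.mem_compl_iff, Set.mem_ofPred_eq, not_le] at hg; exact hg.le
    have := ENNReal.ofReal_le_ofReal hg'
    rw [ENNReal.ofReal_mul (by norm_num)] at this
    simpa using this
  rw [prob_compl_eq_one_sub hmeas] at hcompl
  have h4 : (1 : ENNReal) ≤ 2⁻¹ + G {g | ‖g‖ ^ 2 ≤ 2 * d} := tsub_le_iff_right.mp hcompl
  rw [← ENNReal.inv_two_add_inv_two] at h4
  exact (ENNReal.add_le_add_iff_left (by simp)).mp h4

open Metric Module in
theorem card_le_of_separated_sphere {E : Type*} [NormedAddCommGroup E] [NormedSpace ℝ E]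
    [FiniteDimensional ℝ E] {η : ℝ} (hη : 0 < η) (s : Finset E) (hs : ∀ c ∈ s, ‖c‖ = 1)
    (h : ∀ c ∈ s, ∀ d ∈ s, c ≠ d → η ≤ ‖c - d‖) :
    (s.card : ℝ) ≤ (1 + 2 / η) ^ finrank ℝ E := by
  borelize E
  let μ : Measure E := Measure.addHaar
  have hδ : 0 < η / 2 := by positivity
  have hρ : 0 < 1 + η / 2 := by positivity
  have hdisj : Set.Pairwise (s : Set E) (Function.onFun Disjoint fun c => ball (c : E) (η / 2)) := by
    rintro c hc d hd hcd
    apply ball_disjoint_ball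
    rw [dist_eq_norm]
    have := h c hc d hd hcd
    linarith
  have hsub : (⋃ c ∈ s, ball (c : E) (η / 2)) ⊆ ball (0 : E) (1 + η / 2) := by
    refine Set.iUnion₂_subset fun x hx => ball_subset_ball' ?_
    rw [dist_zero_right, hs x hx, add_comm]
  have hvol : (s.card : ENNReal) * ENNReal.ofReal ((η / 2) ^ finrank ℝ E) * μ (ball 0 1) ≤
      ENNReal.ofReal ((1 + η / 2) ^ finrank ℝ E) * μ (ball 0 1) :=
    calc
      _ = μ (⋃ c ∈ s, ball (c : E) (η / 2)) := by
        rw [measure_biUnion_finset hdisj fun c _ => measurableSet_ball]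
        simp only [μ.addHaar_ball_of_pos _ hδ]
        simp only [Finset.sum_const, nsmul_eq_mul, mul_assoc]
      _ ≤ μ (ball (0 : E) (1 + η / 2)) := measure_mono hsub
      _ = _ := by simp only [μ.addHaar_ball_of_pos _ hρ]
  have hcard := ENNReal.toReal_le_of_le_ofReal (pow_nonneg hρ.le _)
    ((ENNReal.mul_le_mul_iff_left (measure_ball_pos _ _ zero_lt_one).ne'
      measure_ball_lt_top.ne).1 hvol)
  have hpow : (0 : ℝ) < (η / 2) ^ finrank ℝ E := by positivity
  rw [ENNReal.toReal_mul, ENNReal.toReal_natCast, ENNReal.toReal_ofReal hpow.le,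
    ← le_div_iff₀ hpow, ← div_pow] at hcard
  refine hcard.trans_eq ?_
  congr 1
  field_simp
  ring

open Module in
theorem exists_sphere_net (E : Type*) [NormedAddCommGroup E] [NormedSpace ℝ E]
    [FiniteDimensional ℝ E] {η : ℝ} (hη : 0 < η) :
    ∃ s : Finset E, (∀ c ∈ s, ‖c‖ = 1) ∧ (∀ z : E, ‖z‖ = 1 → ∃ c ∈ s, ‖z - c‖ < η) ∧
      (s.card : ℝ) ≤ (1 + 2 / η) ^ finrank ℝ E := by
  classical
  let S : Set (Finset E) :=
    {s | (∀ c ∈ s, ‖c‖ = 1) ∧ ∀ c ∈ s, ∀ d ∈ s, c ≠ d → η ≤ ‖c - d‖}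
  have hbdd : BddAbove (Finset.card '' S) := by
    refine ⟨⌊(1 + 2 / η) ^ finrank ℝ E⌋₊, ?_⟩
    rintro _ ⟨s, hs, rfl⟩
    exact Nat.le_floor (card_le_of_separated_sphere hη s hs.1 hs.2)
  have hne : (Finset.card '' S).Nonempty := ⟨_, ∅, by simp [S], rfl⟩
  obtain ⟨s, hs, hmax⟩ := Nat.sSup_mem hne hbdd
  refine ⟨s, hs.1, fun z hz => ?_, card_le_of_separated_sphere hη s hs.1 hs.2⟩
  by_contra! hfar
  have hzs : z ∉ s := fun hzs => by simpa using hη.trans_le (hfar z hzs)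
  have hins : insert z s ∈ S := by
    refine ⟨fun c hc => ?_, fun c hc d hd hcd => ?_⟩
    · rcases Finset.mem_insert.mp hc with rfl | hc
      exacts [hz, hs.1 c hc]
    · rcases Finset.mem_insert.mp hc with hc | hc <;>
        rcases Finset.mem_insert.mp hd with hd | hd
      · exact absurd (hc.trans hd.symm) hcd
      · exact hc ▸ hfar d hd
      · rw [norm_sub_rev]; exact hd ▸ hfar c hc
      · exact hs.2 c hc d hd hcd
  have := le_csSup hbdd ⟨_, hins, rfl⟩
  rw [← hmax, Finset.card_insert_of_notMem hzs] at this
  omega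

theorem measure_pi_card_filter_le {Ω : Type*} [MeasurableSpace Ω] (μ : Measure Ω)
    [IsProbabilityMeasure μ] {B : Set Ω} [DecidablePred (· ∈ B)]
    (hB : MeasurableSet B) (hμB : μ.real B ≤ 1 / 3) (D : ℕ) :
    (Measure.pi fun _ : Fin D => μ).real
        {ω | 2 * (D : ℝ) / 3 ≤ (Finset.univ.filter fun k => ω k ∈ B).card} ≤
      Real.exp (-(D / 3 * Real.log 2)) := by
  let f : Ω → ℝ := fun x => 1 + B.indicator (fun _ => 3) x
  have hf1 : ∀ x, f x = if x ∈ B then 4 else 1 := fun x => by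
    by_cases hx : x ∈ B <;> simp [f, hx]
    norm_num
  have hind : Integrable (B.indicator fun _ : Ω => (3 : ℝ)) μ :=
    (integrable_const _).indicator hB
  have hfi : Integrable f μ := (integrable_const _).add hind
  have hf_le : ∫ x, f x ∂μ ≤ 2 := by
    rw [integral_add (integrable_const _) hind, integral_indicator hB]
    simp
    linarith
  have hf_nonneg : 0 ≤ ∫ x, f x ∂μ := integral_nonneg fun x => by
    simp only [Pi.zero_apply]; rw [hf1]; split_ifs <;> norm_num
  have hprod (ω : Fin D → Ω) : ∏ k, f (ω k) =
      Real.exp ((Finset.univ.filter fun k => ω k ∈ B).card * Real.log 4) := by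
    simp_rw [hf1]
    rw [Finset.prod_ite, Finset.prod_const, Finset.prod_const_one, mul_one, mul_comm, Real.exp_mul,
      Real.exp_log (by norm_num), Real.rpow_natCast]
  have hmarkov := mul_meas_ge_le_integral_of_nonneg (μ := Measure.pi fun _ : Fin D => μ)
    (f := fun ω => ∏ k, f (ω k))
    (Filter.Eventually.of_forall fun ω => by
      simp only [Pi.zero_apply]; rw [hprod]; exact (Real.exp_pos _).le)
    (Integrable.fintype_prod fun _ => hfi) (Real.exp (2 * D / 3 * Real.log 4))
  rw [integral_fintype_prod_eq_pow, Fintype.card_fin] at hmarkov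
  simp only [hprod, Real.exp_le_exp, mul_le_mul_iff_left₀ (Real.log_pos (by norm_num : (1:ℝ) < 4))]
    at hmarkov
  rw [← le_div_iff₀' (Real.exp_pos _)] at hmarkov
  refine hmarkov.trans ?_
  rw [div_le_iff₀ (Real.exp_pos _), ← Real.exp_add]
  refine (pow_le_pow_left₀ hf_nonneg hf_le D).trans_eq ?_
  have h4 : Real.log 4 = 2 * Real.log 2 := by
    rw [show (4 : ℝ) = 2 ^ 2 by norm_num, Real.log_pow]; norm_num
  rw [h4, show -(D / 3 * Real.log 2) + 2 * D / 3 * (2 * Real.log 2) = D * Real.log 2 by ring,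
    mul_comm, Real.exp_mul, Real.exp_log two_pos, Real.rpow_natCast]

open ProbabilityTheory in
theorem sphere_small_ball {d : ℕ} (hd : 0 < d) {μ : Measure (Fin d → ℝ)} [IsProbabilityMeasure μ]
    (hsupp : ∀ᵐ a ∂μ, a ⬝ᵥ a = 1)
    (hinv : ∀ Q : Matrix (Fin d) (Fin d) ℝ, Q * Qᵀ = 1 → μ.map Q.mulVec = μ)
    {w : Fin d → ℝ} (hw : w ⬝ᵥ w = 1) {s : ℝ} (hs : 0 ≤ s) :
    μ.real {a | |a ⬝ᵥ w| ≤ s} ≤ 4 * s * √d / √Real.pi := by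
  set G := stdGaussian (EuclideanSpace ℝ (Fin d))
  set τ := s * √(2 * d) with hτ
  let T : Set ((Fin d → ℝ) × EuclideanSpace ℝ (Fin d)) :=
    {q | |inner ℝ (WithLp.toLp 2 q.1) q.2| ≤ τ}
  have hT : MeasurableSet T := measurableSet_le (by fun_prop) measurable_const
  have hupper : (μ.prod G) T ≤ ENNReal.ofReal (2 * τ / √(2 * Real.pi)) := by
    rw [Measure.prod_apply hT]
    calc ∫⁻ a, G (Prod.mk a ⁻¹' T) ∂μ
        ≤ ∫⁻ _, ENNReal.ofReal (2 * τ / √(2 * Real.pi)) ∂μ := by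
          refine lintegral_mono_ae ?_
          filter_upwards [hsupp] with a ha
          refine stdGaussian_abs_inner_le (WithLp.toLp 2 a) ?_ τ
          rw [← sq_eq_sq₀ (norm_nonneg _) zero_le_one, EuclideanSpace.norm_sq_eq, one_pow, ← ha]
          simp [dotProduct, sq]
      _ = _ := by simp
  have hlower : μ {a | |a ⬝ᵥ w| ≤ s} * 2⁻¹ ≤ (μ.prod G) T := by
    rw [Measure.prod_apply_symm hT]
    have hmeas : MeasurableSet {g : EuclideanSpace ℝ (Fin d) | ‖g‖ ^ 2 ≤ 2 * d} :=
      measurableSet_le (by fun_prop) measurable_const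
    calc μ {a | |a ⬝ᵥ w| ≤ s} * 2⁻¹
        ≤ μ {a | |a ⬝ᵥ w| ≤ s} * G {g | ‖g‖ ^ 2 ≤ 2 * d} := by
          gcongr; exact stdGaussian_norm_sq_le hd
      _ = ∫⁻ _ in {g | ‖g‖ ^ 2 ≤ 2 * d}, μ {a | |a ⬝ᵥ w| ≤ s} ∂G := by
          rw [setLIntegral_const]
      _ ≤ ∫⁻ g in {g | ‖g‖ ^ 2 ≤ 2 * d}, μ ((fun a => (a, g)) ⁻¹' T) ∂G := by
          refine setLIntegral_mono' hmeas fun g hg => ?_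
          have hself : (‖g‖ • w) ⬝ᵥ (‖g‖ • w) = WithLp.ofLp g ⬝ᵥ WithLp.ofLp g := by
            rw [smul_dotProduct, dotProduct_smul, hw, smul_eq_mul, smul_eq_mul, mul_one, ← sq,
              EuclideanSpace.norm_sq_eq]
            simp [dotProduct, sq]
          have hpre : (fun a => (a, g)) ⁻¹' T = {a | |a ⬝ᵥ WithLp.ofLp g| ≤ τ} := by
            ext a
            simp [T, EuclideanSpace.inner_eq_star_dotProduct, dotProduct_comm]
          rw [hpre, ← map_dotProduct_eq_of_rotation_invariant hinv hself]
          refine measure_mono fun a ha => ?_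
          simp only [Set.mem_ofPred_eq] at ha hg ⊢
          rw [dotProduct_smul, smul_eq_mul, abs_mul, abs_norm, hτ, mul_comm]
          exact mul_le_mul ha (Real.le_sqrt_of_sq_le hg) (norm_nonneg _) hs
      _ ≤ ∫⁻ g, μ ((fun a => (a, g)) ⁻¹' T) ∂G := setLIntegral_le_lintegral _ _
  have h := hlower.trans hupper
  rw [← div_eq_mul_inv, ENNReal.div_le_iff (by simp) (by simp)] at h
  have h2 := ENNReal.toReal_mono (by finiteness) h
  rw [ENNReal.toReal_mul, ENNReal.toReal_ofReal (by positivity)] at h2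
  refine h2.trans_eq ?_
  rw [hτ, Real.sqrt_mul (by norm_num), Real.sqrt_mul (by norm_num)]
  have h3 : √2 ≠ 0 := by positivity
  have h4 : √Real.pi ≠ 0 := by have := Real.pi_pos; positivity
  simp only [ENNReal.toReal_ofNat]
  field_simp
  ring

theorem frob_sq {n m : ℕ} (M : Matrix (Fin n) (Fin m) ℝ) : frob M ^ 2 = ∑ i, ∑ j, M i j ^ 2 :=
  Real.sq_sqrt (Finset.sum_nonneg fun _ _ => Finset.sum_nonneg fun _ _ => sq_nonneg _)

theorem frob_nonneg {n m : ℕ} (M : Matrix (Fin n) (Fin m) ℝ) : 0 ≤ frob M := Real.sqrt_nonneg _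

theorem permDist_nonneg {n d : ℕ} (X Y : Matrix (Fin n) (Fin d) ℝ) : 0 ≤ permDist X Y :=
  Real.iInf_nonneg fun _ => frob_nonneg _

theorem permDist_sq_le {n d : ℕ} (X Y : Matrix (Fin n) (Fin d) ℝ) (σ : Equiv.Perm (Fin n)) :
    permDist X Y ^ 2 ≤ ∑ i, ∑ l, (X i l - Y (σ i) l) ^ 2 := by
  have h : permDist X Y ≤ frob (X - Y.submatrix σ id) :=
    ciInf_le ⟨0, Set.forall_mem_range.mpr fun _ => frob_nonneg _⟩ σ
  refine (pow_le_pow_left₀ (permDist_nonneg X Y) h 2).trans_eq ?_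
  simp [frob_sq]

theorem exists_perm_sum_sq_sortVec_sub {n : ℕ} (u v : Fin n → ℝ) :
    ∃ σ : Equiv.Perm (Fin n),
      ∑ i, (sortVec u i - sortVec v i) ^ 2 = ∑ i, (u i - v (σ i)) ^ 2 := by
  refine ⟨(Tuple.sort u).symm.trans (Tuple.sort v), ?_⟩
  rw [← Equiv.sum_comp (Tuple.sort u) fun i => (u i - _) ^ 2]
  simp [sortVec]

theorem le_frob_betaEmb_sub_sq {n d D : ℕ} (cols : Fin D → Fin d → ℝ)
    (X Y : Matrix (Fin n) (Fin d) ℝ) (ε : ℝ) (K : Finset (Fin D))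
    (hK : ∀ k ∈ K, ∀ i j, ε ^ 2 * ∑ l, (X i l - Y j l) ^ 2 ≤ ((X i - Y j) ⬝ᵥ cols k) ^ 2) :
    K.card * (ε ^ 2 * permDist X Y ^ 2) ≤
      frob (betaEmb (Matrix.of fun i k => cols k i) X -
        betaEmb (Matrix.of fun i k => cols k i) Y) ^ 2 := by
  rw [frob_sq, Finset.sum_comm, ← nsmul_eq_mul, ← Finset.sum_const]
  refine le_trans (Finset.sum_le_sum fun k hk => ?_) (Finset.sum_le_univ_sum_of_nonneg fun k =>
    Finset.sum_nonneg fun _ _ => sq_nonneg _)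
  obtain ⟨σ, hσ⟩ := exists_perm_sum_sq_sortVec_sub (X *ᵥ cols k) (Y *ᵥ cols k)
  calc ε ^ 2 * permDist X Y ^ 2 ≤ ε ^ 2 * ∑ i, ∑ l, (X i l - Y (σ i) l) ^ 2 := by
        gcongr; exact permDist_sq_le X Y σ
    _ ≤ ∑ i, ((X i - Y (σ i)) ⬝ᵥ cols k) ^ 2 := by
        rw [Finset.mul_sum]; exact Finset.sum_le_sum fun i _ => hK k hk i (σ i)
    _ = ∑ i, ((X *ᵥ cols k) i - (Y *ᵥ cols k) (σ i)) ^ 2 := by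
        simp only [sub_dotProduct]; rfl
    _ = _ := hσ.symm

theorem sq_mul_norm_sq_le_inner_sq {E : Type*} [NormedAddCommGroup E] [InnerProductSpace ℝ E]
    {z w a : E} {ε : ℝ} (hε : 0 ≤ ε) (ha : ‖a‖ = 1) (hwa : 2 * ε ≤ |inner ℝ w a|)
    (hzw : z ≠ 0 → ‖‖z‖⁻¹ • z - w‖ ≤ ε) : ε ^ 2 * ‖z‖ ^ 2 ≤ inner ℝ z a ^ 2 := by
  rcases eq_or_ne z 0 with rfl | hz
  · simp
  have hz0 : 0 < ‖z‖ := norm_pos_iff.mpr hz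
  have h1 : |inner ℝ (‖z‖⁻¹ • z - w) a| ≤ ε := by
    refine (abs_real_inner_le_norm _ _).trans ?_
    rw [ha, mul_one]; exact hzw hz
  rw [inner_sub_left, real_inner_smul_left] at h1
  have h2 : ε ≤ |‖z‖⁻¹ * inner ℝ z a| := by
    have := abs_sub_abs_le_abs_sub (inner ℝ w a) (‖z‖⁻¹ * inner ℝ z a)
    rw [abs_sub_comm] at this
    linarith
  rw [abs_mul, abs_inv, abs_norm, ← div_eq_inv_mul, le_div_iff₀ hz0] at h2
  rw [← mul_pow, ← sq_abs (inner ℝ z a)]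
  exact pow_le_pow_left₀ (by positivity) h2 2

theorem union_bound_numeric {d n D : ℕ} (hn : 0 < n) {y ε N : ℝ} (hy : (n : ℝ) ≤ y)
    (hD : (D : ℝ) ≥ 18 * d * n ^ 2 * Real.log (y + 1)) (hε : 2 / ε ≤ n * y) (hε0 : 0 < ε)
    (hN0 : 0 ≤ N) (hN : N ≤ (1 + 2 / ε) ^ d) :
    N ^ (n * n) * Real.exp (-(D / 3 * Real.log 2)) ≤ Real.exp (-(D : ℝ) / (18 * n ^ 2)) := by
  have hn1 : (1 : ℝ) ≤ n := by exact_mod_cast hn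
  have hy0 : 0 < y + 1 := by linarith
  have hbase : 1 + 2 / ε ≤ (y + 1) ^ 3 := by nlinarith [sq_nonneg y]
  have h1 : N ^ (n * n) ≤ Real.exp (D / 6) := by
    calc N ^ (n * n) ≤ (((y + 1) ^ 3) ^ d) ^ (n * n) := by
          refine pow_le_pow_left₀ hN0 (hN.trans (pow_le_pow_left₀ (by positivity) hbase d)) _
      _ = Real.exp (3 * d * n ^ 2 * Real.log (y + 1)) := by
          rw [mul_comm _ (Real.log _), Real.exp_mul, Real.exp_log hy0, ← pow_mul, ← pow_mul,
            ← Real.rpow_natCast]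
          congr 1; push_cast; ring
      _ ≤ Real.exp (D / 6) := Real.exp_le_exp.mpr (by linarith)
  calc _ ≤ Real.exp (D / 6) * Real.exp (-(D / 3 * Real.log 2)) := by gcongr
    _ ≤ _ := by
      rw [← Real.exp_add, Real.exp_le_exp, neg_div]
      have h2 : (D : ℝ) / (18 * n ^ 2) ≤ D / 18 := by
        gcongr; nlinarith
      have := Real.log_two_gt_d9
      have hD0 : (0 : ℝ) ≤ D := by positivity
      nlinarith

open Classical in
theorem measure_pi_good_ge {d n D : ℕ} (hd : 0 < d) {μ : Measure (Fin d → ℝ)}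
    [IsProbabilityMeasure μ] (hsupp : ∀ᵐ a ∂μ, a ⬝ᵥ a = 1)
    (hinv : ∀ Q : Matrix (Fin d) (Fin d) ℝ, Q * Qᵀ = 1 → μ.map Q.mulVec = μ)
    {ε : ℝ} (hε : 0 < ε) (hsmall : n ^ 2 * (4 * (2 * ε) * √d / √Real.pi) ≤ 1 / 3) :
    ∃ N : ℕ, (N : ℝ) ≤ (1 + 2 / ε) ^ d ∧
      (Measure.pi fun _ : Fin D => μ).real
        {cols | ∀ X Y : Matrix (Fin n) (Fin d) ℝ,
          D / 3 * (ε ^ 2 * permDist X Y ^ 2) ≤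
            frob (betaEmb (Matrix.of fun i k => cols k i) X -
              betaEmb (Matrix.of fun i k => cols k i) Y) ^ 2}ᶜ ≤
        N ^ (n * n) * Real.exp (-(D / 3 * Real.log 2)) := by
  obtain ⟨s, hs1, hsnet, hscard⟩ := exists_sphere_net (EuclideanSpace ℝ (Fin d)) hε
  rw [finrank_euclideanSpace_fin] at hscard
  refine ⟨s.card, hscard, ?_⟩
  let B (w : Fin n × Fin n → s) : Set (Fin d → ℝ) :=
    {a | a ⬝ᵥ a ≠ 1} ∪ ⋃ p, {a | |a ⬝ᵥ WithLp.ofLp (w p).1| ≤ 2 * ε}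
  have hB (w) : MeasurableSet (B w) := by
    refine MeasurableSet.union ?_ (MeasurableSet.iUnion fun p => ?_)
    · refine (measurableSet_eq_fun ?_ measurable_const).compl
      unfold dotProduct; fun_prop
    · refine measurableSet_le ?_ measurable_const
      unfold dotProduct; fun_prop
  have hμB (w) : μ.real (B w) ≤ 1 / 3 := by
    refine (measureReal_union_le _ _).trans ?_
    have h0 : μ.real {a | a ⬝ᵥ a ≠ 1} = 0 := by
      rw [measureReal_def, ae_iff.mp hsupp, ENNReal.toReal_zero]
    rw [h0, zero_add]
    refine ((measureReal_iUnion_fintype_le _).trans ?_).trans hsmall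
    calc _ ≤ ∑ _p : Fin n × Fin n, 4 * (2 * ε) * √d / √Real.pi := by
          refine Finset.sum_le_sum fun p _ => sphere_small_ball hd hsupp hinv ?_ (by positivity)
          have := hs1 _ (w p).2
          have h2 : ‖(w p).1‖ ^ 2 = 1 := by rw [this, one_pow]
          rw [EuclideanSpace.norm_sq_eq] at h2
          rw [← h2]
          simp [dotProduct, sq]
      _ = _ := by simp [sq]
  have hsub : {cols : Fin D → Fin d → ℝ | ∀ X Y : Matrix (Fin n) (Fin d) ℝ,
          D / 3 * (ε ^ 2 * permDist X Y ^ 2) ≤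
            frob (betaEmb (Matrix.of fun i k => cols k i) X -
              betaEmb (Matrix.of fun i k => cols k i) Y) ^ 2}ᶜ ⊆
      ⋃ w, {cols | 2 * (D : ℝ) / 3 ≤ (Finset.univ.filter fun k => cols k ∈ B w).card} := by
    rw [Set.compl_subset_comm]
    intro cols hcols X Y
    simp only [Set.mem_compl_iff, Set.mem_iUnion, Set.mem_ofPred_eq, not_exists, not_le] at hcols
    have hchoice (p : Fin n × Fin n) : ∃ c : s, WithLp.toLp 2 (X p.1 - Y p.2) ≠ 0 →
        ‖‖WithLp.toLp 2 (X p.1 - Y p.2)‖⁻¹ • WithLp.toLp 2 (X p.1 - Y p.2) - c.1‖ ≤ ε := by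
      by_cases hz : WithLp.toLp 2 (X p.1 - Y p.2) = 0
      · have hne : ∃ z : EuclideanSpace ℝ (Fin d), ‖z‖ = 1 :=
          ⟨EuclideanSpace.single ⟨0, hd⟩ 1, by simp⟩
        obtain ⟨z, hz1⟩ := hne
        obtain ⟨c, hc, -⟩ := hsnet z hz1
        exact ⟨⟨c, hc⟩, fun h => absurd hz h⟩
      · obtain ⟨c, hc, hlt⟩ := hsnet (‖WithLp.toLp 2 (X p.1 - Y p.2)‖⁻¹ •
          WithLp.toLp 2 (X p.1 - Y p.2)) (norm_smul_inv_norm (𝕜 := ℝ) hz)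
        exact ⟨⟨c, hc⟩, fun _ => hlt.le⟩
    choose w hw using hchoice
    refine le_trans ?_ (le_frob_betaEmb_sub_sq cols X Y ε
      (Finset.univ.filter fun k => cols k ∉ B w) fun k hk i j => ?_)
    · refine mul_le_mul_of_nonneg_right ?_ (by positivity)
      have h1 := Finset.card_filter_add_card_filter_not (s := (Finset.univ : Finset (Fin D)))
        (fun k => cols k ∈ B w)
      rw [Finset.card_univ, Fintype.card_fin] at h1
      have h2 : ((Finset.univ.filter fun k => cols k ∈ B w).card : ℝ) +
        (Finset.univ.filter fun k => cols k ∉ B w).card = D := by exact_mod_cast h1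
      have := hcols w
      linarith
    · have hkB := (Finset.mem_filter.mp hk).2
      simp only [B, Set.mem_union, Set.mem_iUnion, Set.mem_ofPred_eq, not_or, not_not, not_exists,
        not_le] at hkB
      have hnorm : ‖(WithLp.toLp 2 (cols k) : EuclideanSpace ℝ (Fin d))‖ = 1 := by
        rw [← sq_eq_sq₀ (norm_nonneg _) zero_le_one, EuclideanSpace.norm_sq_eq, one_pow, ← hkB.1]
        simp [dotProduct, sq]
      have h := sq_mul_norm_sq_le_inner_sq hε.le hnorm (w := (w (i, j)).1)
        (by
          rw [EuclideanSpace.inner_eq_star_dotProduct]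
          simpa using (hkB.2 (i, j)).le) (hw (i, j))
      rw [EuclideanSpace.norm_sq_eq, EuclideanSpace.inner_eq_star_dotProduct] at h
      simpa [dotProduct_comm] using h
  refine (measureReal_mono hsub).trans ((measureReal_iUnion_fintype_le _).trans ?_)
  refine (Finset.sum_le_sum (g := fun _ => Real.exp (-(D / 3 * Real.log 2))) fun w _ => ?_).trans_eq
    (by simp)
  exact measure_pi_card_filter_le μ (hB w) (hμB w) D

/-- Let `μ` be the uniform (rotation-invariant) probability measure on the unit sphere
`S^{d-1} ⊂ ℝ^d`. If `D ≥ 18·d·n²·log(48√3·n·√(d + 3·log(√6·n))/√π + 1)` and the columns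
of `A ∈ ℝ^{d×D}` are i.i.d. samples from `μ`, then with probability at least
`1 - exp(-D/(18n²))` the lower Lipschitz bound
`‖β_A(X) - β_A(Y)‖_F ≥ (√π/(24√3))·(d + 3·log(√6·n))^{-1/2}·(√D/n²)·dist(X,Y)` holds
for all `X, Y`. -/
theorem stmt12 (d n D : ℕ)
    (hD : (D : ℝ) ≥ 18 * d * n ^ 2 *
      Real.log (48 * Real.sqrt 3 * n * Real.sqrt ((d : ℝ) + 3 * Real.log (Real.sqrt 6 * n)) /
        Real.sqrt Real.pi + 1))
    (μ : Measure (Fin d → ℝ)) (hprob : IsProbabilityMeasure μ)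
    (hsupp : μ {x : Fin d → ℝ | ∑ i, x i ^ 2 = 1} = 1)
    (hinv : ∀ Q : Matrix (Fin d) (Fin d) ℝ, Q * Qᵀ = 1 → μ.map Q.mulVec = μ) :
    (Measure.pi fun _ : Fin D => μ)
      {cols : Fin D → Fin d → ℝ | ∀ X Y : Matrix (Fin n) (Fin d) ℝ,
        frob (betaEmb (Matrix.of fun i k => cols k i) X -
            betaEmb (Matrix.of fun i k => cols k i) Y) ≥
          Real.sqrt Real.pi / (24 * Real.sqrt 3) *
            (Real.sqrt ((d : ℝ) + 3 * Real.log (Real.sqrt 6 * n)))⁻¹ *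
            (Real.sqrt D / (n : ℝ) ^ 2) * permDist X Y} ≥
      ENNReal.ofReal (1 - Real.exp (-(D : ℝ) / (18 * n ^ 2))) := by
  rcases Nat.eq_zero_or_pos n with rfl | hn
  · simp
  have hd : 0 < d := by
    rcases Nat.eq_zero_or_pos d with rfl | hd
    · simp at hsupp
    · exact hd
  have hn1 : (1 : ℝ) ≤ n := by exact_mod_cast hn
  have hd1 : (1 : ℝ) ≤ d := by exact_mod_cast hd
  have hlog : 0 ≤ Real.log (√6 * n) := by
    refine Real.log_nonneg ?_
    have h6 : 1 ≤ √6 := Real.one_le_sqrt.mpr (by norm_num)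
    nlinarith
  set d' := (d : ℝ) + 3 * Real.log (√6 * n) with hd'
  have hdd' : (d : ℝ) ≤ d' := by linarith
  have hd'0 : 0 < √d' := Real.sqrt_pos.mpr (by linarith)
  have hpi : 0 < √Real.pi := Real.sqrt_pos.mpr Real.pi_pos
  set ε := √Real.pi / (24 * √d' * n ^ 2) with hεdef
  have hε : 0 < ε := by positivity
  have hae : ∀ᵐ a ∂μ, a ⬝ᵥ a = 1 := by
    have hmeas : MeasurableSet {x : Fin d → ℝ | ∑ i, x i ^ 2 = 1} :=
      measurableSet_eq_fun (by fun_prop) measurable_const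
    have h : ∀ᵐ x ∂μ, ∑ i, x i ^ 2 = 1 := (mem_ae_iff_prob_eq_one hmeas).mpr hsupp
    filter_upwards [h] with a ha
    rw [← ha]; simp [dotProduct, sq]
  have hsmall : (n : ℝ) ^ 2 * (4 * (2 * ε) * √d / √Real.pi) ≤ 1 / 3 := by
    have h1 : √d ≤ √d' := Real.sqrt_le_sqrt hdd'
    have h2 : (n : ℝ) ^ 2 * (4 * (2 * ε) * √d / √Real.pi) = √d / √d' * (1 / 3) := by
      rw [hεdef]; field_simp; norm_num
    rw [h2]
    refine mul_le_of_le_one_left (by norm_num) ((div_le_one hd'0).mpr h1)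
  obtain ⟨N, hN, hbad⟩ := measure_pi_good_ge (D := D) hd hae hinv hε hsmall
  set y := 48 * √3 * n * √d' / √Real.pi with hy
  have h3 : 1 ≤ √3 := Real.one_le_sqrt.mpr (by norm_num)
  have hpi2 : √Real.pi ≤ 2 := Real.sqrt_le_iff.mpr ⟨by norm_num, by linarith [Real.pi_le_four]⟩
  have hd'1 : 1 ≤ √d' := Real.one_le_sqrt.mpr (by linarith)
  have hny : (n : ℝ) ≤ y := by
    rw [hy, le_div_iff₀ hpi]
    have h4 : 1 ≤ √3 * √d' := by nlinarith
    nlinarith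
  have hεy : 2 / ε ≤ n * y := by
    have h5 : 2 / ε = 48 * n ^ 2 * √d' / √Real.pi := by rw [hεdef]; field_simp; norm_num
    have h6 : n * y = √3 * (48 * n ^ 2 * √d' / √Real.pi) := by rw [hy]; ring
    rw [h5, h6]
    exact le_mul_of_one_le_left (by positivity) h3
  have hfail := hbad.trans (union_bound_numeric hn hny hD hεy hε (Nat.cast_nonneg N) hN)
  rw [ge_iff_le, ENNReal.ofReal_sub _ (Real.exp_pos _).le, ENNReal.ofReal_one,
    tsub_le_iff_right, ← measure_univ (μ := Measure.pi fun _ : Fin D => μ)]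
  refine (measure_univ_le_add_compl _).trans (add_le_add (measure_mono fun cols hcols X Y => ?_)
    ((ENNReal.le_ofReal_iff_toReal_le (measure_ne_top _ _) (Real.exp_pos _).le).mpr hfail))
  refine le_of_sq_le_sq ?_ (frob_nonneg _)
  refine le_trans (le_of_eq ?_) (hcols X Y)
  rw [hεdef]
  simp only [mul_pow, div_pow, inv_pow, Real.sq_sqrt D.cast_nonneg,
    Real.sq_sqrt (show (0 : ℝ) ≤ 3 by norm_num)]
  field_simp
end

section
/- Let n, D be natural numbers and d > 1 a natural number. Then for every matrix A ∈ ℝ^{d×D} there exist X, Y ∈ ℝ^{n×d} with dist(X,Y) = 1 such that ‖β_A(X) − β_A(Y)‖_F ≤ ((2 + 1/n)^{1/2}·π / n^{1/2}) · (σ_{d−1}(A)² + σ_d(A)²)^{1/2} · dist(X,Y). In particular, the lower Lipschitz constant of β_A with respect to dist is at most ((2 + 1/n)^{1/2}·π / n^{1/2}) · (σ_{d−1}(A)² + σ_d(A)²)^{1/2}. -/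
open Matrix MeasureTheory

/-- `singularValue M k` is the `k`-th largest singular value of `M` (1-based), i.e. the
square root of the `k`-th largest eigenvalue of `M * Mᴴ`; it is `0` when `k - 1 ≥ d`. -/
noncomputable def singularValue {d D : ℕ} (M : Matrix (Fin d) (Fin D) ℝ) (k : ℕ) : ℝ :=
  if h : k - 1 < d then
    Real.sqrt (-(sortVec
      (fun i => -((Matrix.isHermitian_mul_conjTranspose_self M).eigenvalues i)) ⟨k - 1, h⟩))
  else 0

/-- The sorted arrangements minimise the sum of squared differences. -/
theorem sum_sq_sortVec_sub_le {n : ℕ} (x y : Fin n → ℝ) (σ : Equiv.Perm (Fin n)) :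
    ∑ i, (sortVec x i - sortVec y i) ^ 2 ≤ ∑ i, (x (σ i) - y i) ^ 2 := by
  have hx : ∑ i, sortVec x i ^ 2 = ∑ i, x i ^ 2 :=
    Equiv.sum_comp (Tuple.sort x) (fun i => x i ^ 2)
  have hy : ∑ i, sortVec y i ^ 2 = ∑ i, y i ^ 2 :=
    Equiv.sum_comp (Tuple.sort y) (fun i => y i ^ 2)
  have hσ : ∑ i, x (σ i) ^ 2 = ∑ i, x i ^ 2 := Equiv.sum_comp σ (fun i => x i ^ 2)
  have hmono : Monovary (sortVec x) (sortVec y) :=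
    (Tuple.monotone_sort x).monovary (Tuple.monotone_sort y)
  have hxy : ∑ i, x (σ i) * y i ≤ ∑ i, sortVec x i * sortVec y i := by
    have h := hmono.sum_comp_perm_mul_le_sum_mul
      (σ := (Tuple.sort y).trans (σ.trans (Tuple.sort x).symm))
    have h' : ∑ i, x (σ (Tuple.sort y i)) * y (Tuple.sort y i) = ∑ i, x (σ i) * y i :=
      Equiv.sum_comp (Tuple.sort y) (fun i => x (σ i) * y i)
    simpa [sortVec, h'] using h
  simp only [sub_sq, Finset.sum_add_distrib, Finset.sum_sub_distrib, mul_assoc,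
    ← Finset.mul_sum, hx, hy, hσ]
  linarith

/-- A real sequence with `t 0 * t n ≤ 0` changes sign at some step before `n`. -/
theorem exists_mul_succ_nonpos {n : ℕ} (hn : 1 ≤ n) (t : ℕ → ℝ) (h : t 0 * t n ≤ 0) :
    ∃ m < n, t m * t (m + 1) ≤ 0 := by
  by_contra! hpos
  have key : ∀ k, k < n → 0 < t 0 * t (k + 1) := by
    intro k
    induction k with
    | zero => exact hpos 0
    | succ k ih =>
      intro hk
      have h1 := mul_pos (ih (by omega)) (hpos (k + 1) hk)
      have h2 : t 0 * t (k + 1) * (t (k + 1) * t (k + 1 + 1)) =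
        (t 0 * t (k + 1 + 1)) * t (k + 1) ^ 2 := by ring
      rw [h2] at h1
      exact pos_of_mul_pos_left h1 (sq_nonneg _)
  have := key (n - 1) (by omega)
  rw [Nat.sub_add_cancel hn] at this
  linarith

/-- If consecutive terms of `t 0, …, t n` have squared distance at most `B` and `t 0`, `t n` have
opposite signs, then replacing `t 0` by `0` changes the sorted vector by at most `n * B`. -/
theorem sum_sq_sortVec_update_zero_le {n : ℕ} [NeZero n] (t : ℕ → ℝ) {B : ℝ}
    (h : t 0 * t n ≤ 0) (hB : ∀ j, (t (j + 1) - t j) ^ 2 ≤ B) :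
    ∑ i, (sortVec (fun i : Fin n => if i = 0 then 0 else t i) i -
      sortVec (fun i : Fin n => t i) i) ^ 2 ≤ n * B := by
  obtain ⟨m, hm, hsign⟩ := exists_mul_succ_nonpos (NeZero.one_le) t h
  refine (sum_sq_sortVec_sub_le _ _ (Fin.cycleRange ⟨m, hm⟩)).trans ?_
  have hB0 : 0 ≤ B := (sq_nonneg _).trans (hB 0)
  have hterm : ∀ j : Fin n, ((fun i : Fin n => if i = 0 then 0 else t i)
      (Fin.cycleRange ⟨m, hm⟩ j) - t j) ^ 2 ≤ B := by
    intro j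
    rcases lt_trichotomy j ⟨m, hm⟩ with hj | hj | hj
    · have hval := Fin.coe_cycleRange_of_lt hj
      have hne : Fin.cycleRange ⟨m, hm⟩ j ≠ 0 := by
        intro h0
        rw [h0] at hval
        simp at hval
      simp only [hne, if_false, hval]
      exact hB j
    · subst hj
      simp only [Fin.cycleRange_self, if_true]
      nlinarith [hB m, sq_nonneg (t (m + 1))]
    · have hne : j ≠ 0 := by
        rintro rfl
        exact absurd hj (by simp)
      simpa [Fin.cycleRange_of_gt hj, hne] using hB0
  simpa using Finset.sum_le_card_nsmul Finset.univ _ B (fun j _ => hterm j)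

/-- Consecutive points at angles `π j / n` on the unit circle have projections onto `(p, q)` at
squared distance at most `(π / n)² (p² + q²)`. -/
theorem sq_projection_step_le (n j : ℕ) (p q : ℝ) :
    ((p * Real.cos (Real.pi * (j + 1 : ℕ) / n) + q * Real.sin (Real.pi * (j + 1 : ℕ) / n)) -
      (p * Real.cos (Real.pi * j / n) + q * Real.sin (Real.pi * j / n))) ^ 2 ≤
    (Real.pi / n) ^ 2 * (p ^ 2 + q ^ 2) := by
  have hangle : Real.pi * (j + 1 : ℕ) / n = Real.pi * j / n + Real.pi / n := by
    push_cast; ring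
  have hcos := Real.one_sub_sq_div_two_le_cos (x := Real.pi / n)
  rw [hangle]
  generalize Real.pi * j / n = a at *
  generalize Real.pi / (n : ℝ) = b at *
  have hchord : (Real.cos (a + b) - Real.cos a) ^ 2 + (Real.sin (a + b) - Real.sin a) ^ 2 =
      2 - 2 * Real.cos b := by
    rw [Real.cos_add, Real.sin_add]
    linear_combination (Real.sin b ^ 2 + Real.cos b ^ 2 + 1 - 2 * Real.cos b) *
      Real.sin_sq_add_cos_sq a + Real.sin_sq_add_cos_sq b
  generalize Real.cos (a + b) = c₁ at *
  generalize Real.sin (a + b) = s₁ at *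
  have hcs : (p * (c₁ - Real.cos a) + q * (s₁ - Real.sin a)) ^ 2 ≤
      ((c₁ - Real.cos a) ^ 2 + (s₁ - Real.sin a) ^ 2) * (p ^ 2 + q ^ 2) := by
    nlinarith [sq_nonneg (p * (s₁ - Real.sin a) - q * (c₁ - Real.cos a))]
  calc _ = (p * (c₁ - Real.cos a) + q * (s₁ - Real.sin a)) ^ 2 := by ring
    _ ≤ _ := hcs
    _ ≤ _ := by
      rw [hchord]
      exact mul_le_mul_of_nonneg_right (by linarith) (by positivity)

/-- The `n` points at angles `π i / n` on the unit circle of the plane with orthonormal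
basis `u, v`. -/
noncomputable def semicircle (n : ℕ) {d : ℕ} (u v : Fin d → ℝ) : Matrix (Fin n) (Fin d) ℝ :=
  Matrix.of fun i l => Real.cos (Real.pi * (i : ℕ) / n) * u l +
    Real.sin (Real.pi * (i : ℕ) / n) * v l

/-- `semicircle n u v` with its first point moved to the origin. -/
noncomputable def puncturedSemicircle (n : ℕ) [NeZero n] {d : ℕ} (u v : Fin d → ℝ) :
    Matrix (Fin n) (Fin d) ℝ :=
  Matrix.of fun i l => if i = 0 then 0 else semicircle n u v i l

theorem sum_sq_semicircle_row {n d : ℕ} {u v : Fin d → ℝ} (hu : u ⬝ᵥ u = 1) (hv : v ⬝ᵥ v = 1)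
    (huv : u ⬝ᵥ v = 0) (i : Fin n) : ∑ l, semicircle n u v i l ^ 2 = 1 := by
  simp only [semicircle, Matrix.of_apply]
  generalize Real.pi * (i : ℕ) / n = a
  calc _ = Real.cos a ^ 2 * (u ⬝ᵥ u) + 2 * Real.cos a * Real.sin a * (u ⬝ᵥ v) +
        Real.sin a ^ 2 * (v ⬝ᵥ v) := by
        simp only [dotProduct, Finset.mul_sum, ← Finset.sum_add_distrib]
        exact Finset.sum_congr rfl fun l _ => by ring
    _ = 1 := by rw [hu, hv, huv]; linarith [Real.sin_sq_add_cos_sq a]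

theorem permDist_puncturedSemicircle {n d : ℕ} [NeZero n] {u v : Fin d → ℝ}
    (hu : u ⬝ᵥ u = 1) (hv : v ⬝ᵥ v = 1) (huv : u ⬝ᵥ v = 0) :
    permDist (puncturedSemicircle n u v) (semicircle n u v) = 1 := by
  refine le_antisymm ?_ (le_ciInf fun σ => ?_)
  · refine (ciInf_le ⟨0, ?_⟩ (Equiv.refl _)).trans_eq ?_
    · rintro _ ⟨σ, rfl⟩
      exact Real.sqrt_nonneg _
    · rw [frob, Real.sqrt_eq_one, Finset.sum_eq_single 0]
      · simpa [puncturedSemicircle] using sum_sq_semicircle_row hu hv huv (0 : Fin n)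
      · intro i _ hi
        simp [puncturedSemicircle, hi]
      · simp
  · rw [frob, Real.one_le_sqrt]
    refine le_trans ?_ (Finset.single_le_sum
      (f := fun i => ∑ j, (puncturedSemicircle n u v - (semicircle n u v).submatrix σ id) i j ^ 2)
      (fun i _ => Finset.sum_nonneg fun j _ => sq_nonneg _) (Finset.mem_univ (0 : Fin n)))
    simpa [puncturedSemicircle] using (sum_sq_semicircle_row hu hv huv (σ 0)).ge

theorem semicircle_mulVec {n d : ℕ} (u v w : Fin d → ℝ) :
    (semicircle n u v).mulVec w = fun i : Fin n =>
      (u ⬝ᵥ w) * Real.cos (Real.pi * (i : ℕ) / n) +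
        (v ⬝ᵥ w) * Real.sin (Real.pi * (i : ℕ) / n) := by
  ext i
  simp only [Matrix.mulVec, semicircle, dotProduct, Matrix.of_apply, Finset.sum_mul,
    ← Finset.sum_add_distrib]
  exact Finset.sum_congr rfl fun l _ => by ring

theorem puncturedSemicircle_mulVec {n d : ℕ} [NeZero n] (u v w : Fin d → ℝ) :
    (puncturedSemicircle n u v).mulVec w = fun i : Fin n =>
      if i = 0 then 0 else (semicircle n u v).mulVec w i := by
  ext i
  by_cases hi : i = 0 <;> simp [Matrix.mulVec, puncturedSemicircle, dotProduct, hi]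

theorem sum_sq_betaEmb_semicircle_le {n d D : ℕ} [NeZero n] (A : Matrix (Fin d) (Fin D) ℝ)
    (u v : Fin d → ℝ) :
    ∑ i, ∑ k, (betaEmb A (puncturedSemicircle n u v) - betaEmb A (semicircle n u v)) i k ^ 2 ≤
      Real.pi ^ 2 / n * (∑ k, (u ᵥ* A) k ^ 2 + ∑ k, (v ᵥ* A) k ^ 2) := by
  have hn : (n : ℝ) ≠ 0 := Nat.cast_ne_zero.mpr (NeZero.ne n)
  rw [Finset.sum_comm, ← Finset.sum_add_distrib, Finset.mul_sum]
  refine Finset.sum_le_sum fun k _ => ?_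
  have h := sum_sq_sortVec_update_zero_le (n := n)
    (fun j => (u ᵥ* A) k * Real.cos (Real.pi * j / n) + (v ᵥ* A) k * Real.sin (Real.pi * j / n))
    (by
      simp only [mul_div_cancel_right₀ _ hn]
      simp
      nlinarith [sq_nonneg ((u ᵥ* A) k)])
    (fun j => sq_projection_step_le n j ((u ᵥ* A) k) ((v ᵥ* A) k))
  refine (le_of_eq ?_).trans (h.trans_eq ?_)
  · simp only [betaEmb, Matrix.sub_apply, Matrix.of_apply, puncturedSemicircle_mulVec,
      semicircle_mulVec]
    rfl
  · field_simp

/-- The two smallest singular values are attained on an orthonormal pair of left singular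
vectors. -/
theorem exists_orthonormal_pair_singularValue {d D : ℕ} (hd : 1 < d)
    (A : Matrix (Fin d) (Fin D) ℝ) :
    ∃ u v : Fin d → ℝ, u ⬝ᵥ u = 1 ∧ v ⬝ᵥ v = 1 ∧ u ⬝ᵥ v = 0 ∧
      ∑ k, (u ᵥ* A) k ^ 2 = singularValue A (d - 1) ^ 2 ∧
      ∑ k, (v ᵥ* A) k ^ 2 = singularValue A d ^ 2 := by
  set hH := Matrix.isHermitian_mul_conjTranspose_self A
  set s := Tuple.sort (fun i => -(hH.eigenvalues i))
  have hsv : ∀ (k : ℕ) (h : k - 1 < d),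
      singularValue A k ^ 2 = hH.eigenvalues (s ⟨k - 1, h⟩) := by
    intro k h
    rw [singularValue, dif_pos h]
    simp only [sortVec, Function.comp_apply, neg_neg]
    exact Real.sq_sqrt ((Matrix.posSemidef_self_mul_conjTranspose A).eigenvalues_nonneg _)
  have hdot : ∀ i j, (hH.eigenvectorBasis i).ofLp ⬝ᵥ (hH.eigenvectorBasis j).ofLp =
      if i = j then 1 else 0 := by
    intro i j
    rw [← orthonormal_iff_ite.mp hH.eigenvectorBasis.orthonormal i j]
    simp [EuclideanSpace.inner_eq_star_dotProduct, dotProduct_comm]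
  have hval : ∀ i, ∑ k, ((hH.eigenvectorBasis i).ofLp ᵥ* A) k ^ 2 = hH.eigenvalues i := by
    intro i
    have h := hH.mulVec_eigenvectorBasis i
    set w := (hH.eigenvectorBasis i).ofLp with hw
    calc _ = (w ᵥ* A) ⬝ᵥ (w ᵥ* A) := by simp [dotProduct, sq]
      _ = w ⬝ᵥ ((A * Aᴴ) *ᵥ w) := by
        rw [← Matrix.mulVec_mulVec, Matrix.dotProduct_mulVec,
          Matrix.conjTranspose_eq_transpose_of_trivial, Matrix.mulVec_transpose]
      _ = hH.eigenvalues i * (w ⬝ᵥ w) := by rw [h, dotProduct_smul, smul_eq_mul]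
      _ = hH.eigenvalues i := by rw [hw, hdot, if_pos rfl, mul_one]
  have hne : s ⟨d - 1 - 1, by omega⟩ ≠ s ⟨d - 1, by omega⟩ := by
    intro h
    have := congrArg Fin.val (s.injective h)
    simp only at this
    omega
  refine ⟨_, _, ?_, ?_, ?_, (hval _).trans (hsv (d - 1) (by omega)).symm,
    (hval _).trans (hsv d (by omega)).symm⟩
  · rw [hdot, if_pos rfl]
  · rw [hdot, if_pos rfl]
  · rw [hdot, if_neg hne]

/-- For `d > 1` and any `A ∈ ℝ^{d×D}` there are `X, Y` with `dist(X,Y) = 1` witnessing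
that the lower Lipschitz constant of `β_A` is at most
`((2+1/n)^{1/2}·π/n^{1/2})·(σ_{d-1}(A)² + σ_d(A)²)^{1/2}`. -/
theorem stmt13 (n D d : ℕ) (hn : 1 ≤ n) (hd : 1 < d) (A : Matrix (Fin d) (Fin D) ℝ) :
    ∃ X Y : Matrix (Fin n) (Fin d) ℝ, permDist X Y = 1 ∧
      frob (betaEmb A X - betaEmb A Y) ≤
        Real.sqrt (2 + 1 / (n : ℝ)) * Real.pi / Real.sqrt n *
          Real.sqrt (singularValue A (d - 1) ^ 2 + singularValue A d ^ 2) * permDist X Y := by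
  have : NeZero n := ⟨by omega⟩
  obtain ⟨u, v, hu, hv, huv, hsu, hsv⟩ := exists_orthonormal_pair_singularValue hd A
  have hdist := permDist_puncturedSemicircle (n := n) hu hv huv
  refine ⟨_, _, hdist, ?_⟩
  have hle := sum_sq_betaEmb_semicircle_le (n := n) A u v
  rw [hsu, hsv] at hle
  have hconst : Real.sqrt (2 + 1 / (n : ℝ)) * Real.pi / Real.sqrt n =
      Real.sqrt ((2 + 1 / (n : ℝ)) * Real.pi ^ 2 / n) := by
    rw [Real.sqrt_div (by positivity), Real.sqrt_mul (by positivity),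
      Real.sqrt_sq Real.pi_pos.le]
  rw [hdist, mul_one, hconst, ← Real.sqrt_mul (by positivity), frob]
  refine Real.sqrt_le_sqrt (hle.trans ?_)
  gcongr
  have : 0 ≤ 1 / (n : ℝ) := by positivity
  nlinarith [sq_nonneg Real.pi]
end

section
/- Let n ≥ 2, d ≥ 1, D ≥ 2 be natural numbers and let A ∈ ℝ^{d×D}. Then there exist a natural number r ≤ (n²·D)^{2nd} and linear maps 𝒜_1, …, 𝒜_r : ℝ^{n×d} × ℝ^{n×d} → ℝ^{n×D} such that for every pair (X, Y) ∈ ℝ^{n×d} × ℝ^{n×d} there is an index t ∈ [r] with β_A(X) − β_A(Y) = 𝒜_t(X, Y). In other words, the map (X,Y) ↦ β_A(X) − β_A(Y) is piecewise linear with at most (n²·D)^{2nd} linear pieces. -/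
open Matrix MeasureTheory

/-- The set of indices at which the functionals `f` are positive at `x`. -/
noncomputable def positiveIndices {ι V : Type*} [Fintype ι] [AddCommGroup V] [Module ℝ V]
    (f : ι → Module.Dual ℝ V) (x : V) : Finset ι :=
  Finset.univ.filter fun j => 0 < f j x

@[simp]
theorem mem_positiveIndices {ι V : Type*} [Fintype ι] [AddCommGroup V] [Module ℝ V]
    {f : ι → Module.Dual ℝ V} {x : V} {j : ι} : j ∈ positiveIndices f x ↔ 0 < f j x := by
  simp [positiveIndices]

/-- A set of functionals shattered by the positivity patterns is linearly independent. -/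
theorem linearIndependent_of_shatters {ι V : Type*} [Fintype ι] [DecidableEq ι] [AddCommGroup V]
    [Module ℝ V] (f : ι → Module.Dual ℝ V) {𝒜 : Finset (Finset ι)}
    (h𝒜 : ∀ t ∈ 𝒜, ∃ x, positiveIndices f x = t) {s : Finset ι} (hs : 𝒜.Shatters s) :
    LinearIndependent ℝ fun j : s => f j := by
  have nonpos (c : s → ℝ) (hc : ∑ j, c j • f j = 0) (i : s) : c i ≤ 0 := by
    by_contra! hi
    obtain ⟨t, ht, hst⟩ := hs (t := (Finset.univ.filter fun j : s => 0 < c j).map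
      (Function.Embedding.subtype _)) (fun j hj => by
        obtain ⟨k, -, rfl⟩ := Finset.mem_map.1 hj
        exact k.2)
    obtain ⟨x, rfl⟩ := h𝒜 t ht
    have key (j : s) : 0 < f j x ↔ 0 < c j := by
      have := congrArg (fun u : Finset ι => (j : ι) ∈ u) hst
      simpa using this
    have hsum : ∑ j, c j * f j x = 0 := by
      simpa using congrArg (fun g : Module.Dual ℝ V => g x) hc
    have hterm (j : s) : 0 ≤ c j * f j x := by
      rcases lt_or_ge 0 (c j) with hj | hj
      · exact (mul_pos hj ((key j).2 hj)).le
      · exact mul_nonneg_of_nonpos_of_nonpos hj (not_lt.1 fun h => hj.not_gt ((key j).1 h))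
    exact ((Finset.sum_pos' (fun j _ => hterm j)
      ⟨i, Finset.mem_univ _, mul_pos hi ((key i).2 hi)⟩).ne' hsum)
  rw [Fintype.linearIndependent_iff]
  intro c hc i
  refine le_antisymm (nonpos c hc i) ?_
  have hneg : ∑ j, (-c) j • f j = 0 := by
    ext x
    simpa using congrArg (fun g : Module.Dual ℝ V => g x) hc
  simpa using nonpos (-c) hneg i

/-- A sum of binomial coefficients is bounded by a power. -/
theorem sum_Iic_choose_le_pow (m N : ℕ) : ∑ k ∈ Finset.Iic N, m.choose k ≤ (m + 1) ^ N := by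
  rw [add_pow, Nat.range_succ_eq_Iic]
  refine Finset.sum_le_sum fun k hk => ?_
  have hpos : 0 < N.choose k := Nat.choose_pos (Finset.mem_Iic.1 hk)
  calc m.choose k ≤ m ^ k := Nat.choose_le_pow m k
    _ ≤ m ^ k * 1 ^ (N - k) * N.choose k := by
      simpa using Nat.le_mul_of_pos_right (m ^ k) hpos

/-- `m` linear functionals on an `N`-dimensional space have at most `(m + 1) ^ N`
positivity patterns. -/
theorem card_range_positiveIndices_le {ι V : Type*} [Fintype ι] [AddCommGroup V] [Module ℝ V]
    [FiniteDimensional ℝ V] (f : ι → Module.Dual ℝ V) :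
    Nat.card (Set.range (positiveIndices f)) ≤
      (Fintype.card ι + 1) ^ Module.finrank ℝ V := by
  classical
  set 𝒜 : Finset (Finset ι) := (Set.range (positiveIndices f)).toFinset with h𝒜
  have hvc : 𝒜.vcDim ≤ Module.finrank ℝ V := by
    refine Finset.sup_le fun s hs => ?_
    have := (linearIndependent_of_shatters f (𝒜 := 𝒜) (by simp [h𝒜])
      (Finset.mem_shatterer.1 hs)).fintype_card_le_finrank
    simpa [Subspace.dual_finrank_eq] using this
  calc Nat.card (Set.range (positiveIndices f)) = 𝒜.card := by
        rw [h𝒜, Set.toFinset_card, Nat.card_eq_fintype_card]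
    _ ≤ 𝒜.shatterer.card := 𝒜.card_le_card_shatterer
    _ ≤ ∑ k ∈ Finset.Iic 𝒜.vcDim, (Fintype.card ι).choose k :=
        Finset.card_shatterer_le_sum_vcDim
    _ ≤ (Fintype.card ι + 1) ^ 𝒜.vcDim := sum_Iic_choose_le_pow _ _
    _ ≤ _ := Nat.pow_le_pow_right (Nat.succ_pos _) hvc

/-- The functionals `X ↦ (X a_k) i - (X a_k) j` for distinct rows `i`, `j` and a column `k`. -/
noncomputable def rowDifference {n d D : ℕ} (A : Matrix (Fin d) (Fin D) ℝ)
    (p : (Finset.univ : Finset (Fin n)).offDiag × Fin D) :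
    Module.Dual ℝ (Matrix (Fin n) (Fin d) ℝ) where
  toFun X := (X * A) p.1.1.1 p.2 - (X * A) p.1.1.2 p.2
  map_add' X Y := by simp only [Matrix.add_mul, Matrix.add_apply]; ring
  map_smul' c X := by simp [mul_sub]

/-- Permute the entries of each column of `X * A` by a prescribed permutation. -/
noncomputable def permuteColumns {n d D : ℕ} (A : Matrix (Fin d) (Fin D) ℝ)
    (σ : Fin D → Equiv.Perm (Fin n)) :
    Matrix (Fin n) (Fin d) ℝ →ₗ[ℝ] Matrix (Fin n) (Fin D) ℝ where
  toFun X := Matrix.of fun i k => (X * A) (σ k i) k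
  map_add' X Y := by ext; simp [Matrix.add_mul]
  map_smul' c X := by ext; simp

theorem betaEmb_eq_sort {n d D : ℕ} (A : Matrix (Fin d) (Fin D) ℝ)
    (X : Matrix (Fin n) (Fin d) ℝ) :
    betaEmb A X = permuteColumns A (fun k => Tuple.sort fun i => (X * A) i k) X := rfl

/-- Matrices with the same positivity pattern are sorted by the same permutations. -/
theorem betaEmb_eq_of_positiveIndices_eq {n d D : ℕ} (A : Matrix (Fin d) (Fin D) ℝ)
    {X Z : Matrix (Fin n) (Fin d) ℝ}
    (h : positiveIndices (rowDifference A) Z = positiveIndices (rowDifference A) X) :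
    betaEmb A X = permuteColumns A (fun k => Tuple.sort fun i => (Z * A) i k) X := by
  have hlt (i j : Fin n) (k : Fin D) :
      (X * A) i k < (X * A) j k → (Z * A) i k < (Z * A) j k := by
    intro hX
    have hij : j ≠ i := by rintro rfl; exact lt_irrefl _ hX
    let p : (Finset.univ : Finset (Fin n)).offDiag × Fin D := (⟨(j, i), by simpa using hij⟩, k)
    have hp : p ∈ positiveIndices (rowDifference A) X :=
      mem_positiveIndices.2 (sub_pos.2 hX)
    rw [← h] at hp
    exact sub_pos.1 (mem_positiveIndices.1 hp)
  rw [betaEmb_eq_sort]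
  ext i k
  have hmono : Monotone ((fun i => (X * A) i k) ∘ Tuple.sort fun i => (Z * A) i k) :=
    fun a b hab => not_lt.1 fun hX =>
      (Tuple.monotone_sort (fun i => (Z * A) i k) hab).not_gt (hlt _ _ k hX)
  exact (congrFun (Tuple.comp_sort_eq_comp_iff_monotone.2 hmono) i).symm

theorem card_offDiag_prod_add_one_le {n D : ℕ} (hn : 1 ≤ n) (hD : 1 ≤ D) :
    Fintype.card ((Finset.univ : Finset (Fin n)).offDiag × Fin D) + 1 ≤ n ^ 2 * D := by
  rw [Fintype.card_prod, Fintype.card_coe, Finset.offDiag_card, Finset.card_univ,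
    Fintype.card_fin, Fintype.card_fin, Nat.sub_mul, ← sq]
  have h₁ : n * D ≤ n ^ 2 * D := Nat.mul_le_mul_right D (Nat.le_self_pow two_ne_zero n)
  have h₂ : 1 ≤ n * D := Nat.mul_pos hn hD
  omega

/-- The map `(X,Y) ↦ β_A(X) - β_A(Y)` is piecewise linear with at most `(n²·D)^{2nd}`
linear pieces. -/
theorem stmt15 (n d D : ℕ) (hn : 2 ≤ n) (hd : 1 ≤ d) (hD : 2 ≤ D)
    (A : Matrix (Fin d) (Fin D) ℝ) :
    ∃ r : ℕ, r ≤ (n ^ 2 * D) ^ (2 * n * d) ∧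
      ∃ 𝒜 : Fin r →
          (Matrix (Fin n) (Fin d) ℝ × Matrix (Fin n) (Fin d) ℝ) →ₗ[ℝ] Matrix (Fin n) (Fin D) ℝ,
        ∀ X Y : Matrix (Fin n) (Fin d) ℝ, ∃ t : Fin r,
          betaEmb A X - betaEmb A Y = 𝒜 t (X, Y) := by
  classical
  let T := Set.range (positiveIndices (rowDifference (n := n) A))
  choose Z hZ using fun t : T => t.2
  let σ (t : T) (k : Fin D) : Equiv.Perm (Fin n) := Tuple.sort fun i => (Z t * A) i k
  have hT : Nat.card T ≤ (n ^ 2 * D) ^ (n * d) := by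
    refine (card_range_positiveIndices_le (rowDifference (n := n) A)).trans ?_
    rw [Module.finrank_matrix, Module.finrank_self, mul_one, Fintype.card_fin, Fintype.card_fin]
    exact Nat.pow_le_pow_left (card_offDiag_prod_add_one_le (by omega) (by omega)) _
  refine ⟨Nat.card (T × T), ?_, fun t =>
    permuteColumns A (σ ((Finite.equivFin (T × T)).symm t).1) ∘ₗ LinearMap.fst ℝ _ _ -
      permuteColumns A (σ ((Finite.equivFin (T × T)).symm t).2) ∘ₗ LinearMap.snd ℝ _ _,
    fun X Y => ⟨Finite.equivFin (T × T) (⟨_, X, rfl⟩, ⟨_, Y, rfl⟩), ?_⟩⟩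
  · rw [Nat.card_prod, mul_assoc, two_mul, pow_add]
    exact Nat.mul_le_mul hT hT
  · rw [betaEmb_eq_of_positiveIndices_eq A (hZ ⟨_, X, rfl⟩),
      betaEmb_eq_of_positiveIndices_eq A (hZ ⟨_, Y, rfl⟩)]
    simp [σ]
end

section
/- There exists an absolute constant C > 0 with the following property. Let ε, η ∈ (0,1), let n, d, D ≥ 2 be natural numbers, and let A ∈ ℝ^{d×D} be such that β_A is bi-Lipschitz with lower constant C₁ > 0 and upper constant C₂: C₁·dist(X,Y) ≤ ‖β_A(X) − β_A(Y)‖_F ≤ C₂·dist(X,Y) for all X, Y ∈ ℝ^{n×d}. Then for every natural number M ≥ C·ε^{−2}·(n·d·log(1/ε) + log(1/η) + n·d·log(D·n²)), a random matrix L ∈ ℝ^{M×(nD)} whose entries are independent Gaussians with mean 0 and standard deviation 1/√M satisfies, with probability at least 1 − η: for all X, Y ∈ ℝ^{n×d}, (1−ε)·C₁·dist(X,Y) ≤ ‖L·vec(β_A(X)) − L·vec(β_A(Y))‖₂ ≤ (1+ε)·C₂·dist(X,Y), where vec : ℝ^{n×D} → ℝ^{nD} denotes the flattening map. -/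
open Matrix MeasureTheory

/-- Flattening of an `n × D` matrix into a vector in `ℝ^{nD}`. -/
noncomputable def vecM {n D : ℕ} (M : Matrix (Fin n) (Fin D) ℝ) : Fin (n * D) → ℝ :=
  fun p => M (finProdFinEquiv.symm p).1 (finProdFinEquiv.symm p).2

open ProbabilityTheory in
theorem pi_gaussianReal_map_sum_mul {κ : Type*} [Fintype κ] (v : NNReal) (u : κ → ℝ)
    (hu : ∑ j, u j ^ 2 = 1) :
    (Measure.pi fun _ : κ => gaussianReal 0 v).map (fun x => ∑ j, x j * u j) =
      gaussianReal 0 v := by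
  have hind : iIndepFun (fun j (x : κ → ℝ) => x j * u j)
      (Measure.pi fun _ : κ => gaussianReal 0 v) :=
    iIndepFun_pi (X := fun j (y : ℝ) => y * u j) fun j => by fun_prop
  have hm : AEMeasurable (fun x : κ → ℝ => ∑ j, x j * u j)
      (Measure.pi fun _ : κ => gaussianReal 0 v) :=
    Measurable.aemeasurable (by fun_prop)
  have := Measure.isProbabilityMeasure_map hm
  have hj (j : κ) : (Measure.pi fun _ : κ => gaussianReal 0 v).map (fun x => x j * u j) =
      gaussianReal 0 (.mk (u j ^ 2) (sq_nonneg _) * v) := by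
    have hc := (⟨by fun_prop, gaussianReal_map_const_mul (u j)⟩ : MeasurePreserving
      (u j * ·) (gaussianReal 0 v) _).comp (measurePreserving_eval (fun _ : κ => gaussianReal 0 v) j)
    simpa only [mul_zero, zero_mul, mul_comm (u j) (_ : ℝ), Function.comp_def, Function.eval] using hc.map_eq
  refine Measure.ext_of_charFun ?_
  rw [hind.charFun_map_fun_sum_eq_prod
    (fun j => Measurable.aemeasurable (by fun_prop))]
  ext t
  simp only [Finset.prod_apply, hj, charFun_gaussianReal, ← Complex.exp_sum]
  congr 1
  have hu' : ∑ j, (u j : ℂ) ^ 2 = 1 := by exact_mod_cast hu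
  simp only [Complex.ofReal_zero, mul_zero, zero_mul, zero_sub, NNReal.coe_mul,
    Complex.ofReal_mul, Finset.sum_neg_distrib, NNReal.coe_mk, Complex.ofReal_pow]
  rw [← Finset.sum_div, ← Finset.sum_mul, ← Finset.sum_mul, hu', one_mul]

open ProbabilityTheory in
theorem mgf_sq_gaussianReal {v : NNReal} (hv : v ≠ 0) {s : ℝ} (hs : 2 * v * s < 1) :
    mgf (fun y => y ^ 2) (gaussianReal 0 v) s = (√(1 - 2 * v * s))⁻¹ := by
  have hv' : (0 : ℝ) < v := by positivity
  have hb (y : ℝ) : gaussianPDFReal 0 v y • Real.exp (s * y ^ 2) =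
      (√(2 * Real.pi * v))⁻¹ * Real.exp (-((1 - 2 * v * s) / (2 * v)) * y ^ 2) := by
    rw [gaussianPDFReal_def, smul_eq_mul, mul_assoc, ← Real.exp_add]
    congr 2
    field_simp
    ring
  rw [mgf, integral_gaussianReal_eq_integral_smul hv]
  simp_rw [hb]
  have h1 : 0 < 1 - 2 * v * s := by linarith
  rw [integral_const_mul, integral_gaussian, ← Real.sqrt_inv, ← Real.sqrt_inv,
    ← Real.sqrt_mul (by positivity)]
  congr 1
  field_simp

theorem inv_sqrt_one_sub_le_exp {x : ℝ} (hx : |x| ≤ 1 / 2) :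
    (√(1 - x))⁻¹ ≤ Real.exp ((x + x ^ 2) / 2) := by
  obtain ⟨h1, h2⟩ := abs_le.1 hx
  have h0 : 0 < 1 - x := by linarith
  have key : Real.exp (-(x + x ^ 2)) ≤ 1 - x := by
    rw [Real.exp_neg, inv_le_comm₀ (Real.exp_pos _) h0, inv_le_iff_one_le_mul₀ h0]
    rcases le_total 0 x with hx0 | hx0
    · have := Real.quadratic_le_exp_of_nonneg (x := x + x ^ 2) (by positivity)
      have := mul_le_mul_of_nonneg_right this h0.le
      have hp : 0 ≤ x ^ 2 * ((1 + x) ^ 2 * (1 - x) - 2 * x) :=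
        mul_nonneg (sq_nonneg x) (by nlinarith [mul_nonneg hx0 (sub_nonneg.2 h2)])
      nlinarith
    · have := mul_le_mul_of_nonneg_right (Real.add_one_le_exp (x + x ^ 2)) h0.le
      have hp : 0 ≤ (-x) ^ 3 := pow_nonneg (by linarith) 3
      nlinarith
  rw [inv_le_comm₀ (by positivity) (Real.exp_pos _), ← Real.exp_neg]
  apply Real.le_sqrt_of_sq_le
  rw [← Real.exp_nat_mul]
  convert key using 2
  push_cast; ring

open ProbabilityTheory in
theorem mgf_sum_sq_gaussian_le {ι κ : Type*} [Fintype ι] [Fintype κ] {v : NNReal} (hv : v ≠ 0)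
    {u : κ → ℝ} (hu : ∑ j, u j ^ 2 = 1) {s : ℝ} (hs : |2 * v * s| ≤ 1 / 2) :
    mgf (fun L : ι → κ → ℝ => ∑ i, (∑ j, L i j * u j) ^ 2)
      (Measure.pi fun _ => Measure.pi fun _ => gaussianReal 0 v) s ≤
      Real.exp (Fintype.card ι * ((2 * v * s + (2 * v * s) ^ 2) / 2)) ∧
    Integrable (fun L : ι → κ → ℝ => Real.exp (s * ∑ i, (∑ j, L i j * u j) ^ 2))
      (Measure.pi fun _ => Measure.pi fun _ => gaussianReal 0 v) := by
  have hs1 : 2 * v * s < 1 := by linarith [(abs_le.1 hs).2]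
  have hind : iIndepFun (fun (i : ι) (L : ι → κ → ℝ) => (∑ j, L i j * u j) ^ 2)
      (Measure.pi fun _ => Measure.pi fun _ => gaussianReal 0 v) :=
    iIndepFun_pi (X := fun (i : ι) (y : κ → ℝ) => (∑ j, y j * u j) ^ 2) fun i =>
      Measurable.aemeasurable (by fun_prop)
  have hi (i : ι) : mgf (fun L : ι → κ → ℝ => (∑ j, L i j * u j) ^ 2)
      (Measure.pi fun _ => Measure.pi fun _ => gaussianReal 0 v) s =
      (√(1 - 2 * v * s))⁻¹ := by
    have hm : Measurable fun x : κ → ℝ => ∑ j, x j * u j := by fun_prop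
    have hlaw := (⟨hm, pi_gaussianReal_map_sum_mul v u hu⟩ : MeasurePreserving _ _ _).comp
      (measurePreserving_eval (fun _ : ι => Measure.pi fun _ : κ => gaussianReal 0 v) i)
    rw [← mgf_sq_gaussianReal hv hs1]
    conv_rhs => rw [← hlaw.map_eq]
    rw [mgf_map hlaw.measurable.aemeasurable (Measurable.aestronglyMeasurable (by fun_prop))]
    rfl
  have hmgf := hind.mgf_sum (t := s) (fun i => by fun_prop) Finset.univ
  simp only [hi, Finset.prod_const, Finset.card_univ] at hmgf
  rw [Finset.sum_fn] at hmgf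
  constructor
  · rw [hmgf, Real.exp_nat_mul]
    gcongr
    exact inv_sqrt_one_sub_le_exp hs
  · by_contra hcon
    have := mgf_undef hcon
    rw [hmgf] at this
    have : 0 < (√(1 - 2 * v * s))⁻¹ := by
      have : 0 < 1 - 2 * v * s := by linarith
      positivity
    have := pow_pos this (Fintype.card ι)
    linarith

open ProbabilityTheory in
theorem measureReal_abs_sum_sq_sub_one_gt_le {M : ℕ} {κ : Type*} [Fintype κ] (hM : 0 < M)
    {u : κ → ℝ} (hu : ∑ j, u j ^ 2 = 1) {t : ℝ} (ht0 : 0 ≤ t) (ht1 : t ≤ 1) :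
    (Measure.pi fun _ : Fin M => Measure.pi fun _ : κ => gaussianReal 0 (1 / (M : NNReal))).real
      {L | t < |∑ i, (∑ j, L i j * u j) ^ 2 - 1|} ≤ 2 * Real.exp (-(M * t ^ 2 / 8)) := by
  have hM' : (0 : ℝ) < M := by exact_mod_cast hM
  have hv : (1 / (M : NNReal)) ≠ 0 := by positivity
  have e1 : 2 * ((1 / (M : NNReal) : NNReal) : ℝ) * (M * t / 4) = t / 2 := by
    push_cast; field_simp; ring
  have e2 : 2 * ((1 / (M : NNReal) : NNReal) : ℝ) * (-(M * t / 4)) = -(t / 2) := by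
    push_cast; field_simp; ring
  obtain ⟨h1, h1'⟩ := mgf_sum_sq_gaussian_le (ι := Fin M) hv hu (s := M * t / 4)
    (by rw [e1, abs_le]; constructor <;> linarith)
  obtain ⟨h2, h2'⟩ := mgf_sum_sq_gaussian_le (ι := Fin M) hv hu (s := -(M * t / 4))
    (by rw [e2, abs_le]; constructor <;> linarith)
  have c1 := measure_ge_le_exp_mul_mgf (1 + t) (by positivity) h1'
  have c2 := measure_le_le_exp_mul_mgf (1 - t) (by simp; positivity) h2'
  have c1' := c1.trans (mul_le_mul_of_nonneg_left h1 (Real.exp_pos _).le)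
  have c2' := c2.trans (mul_le_mul_of_nonneg_left h2 (Real.exp_pos _).le)
  rw [← Real.exp_add, e1] at c1'
  rw [← Real.exp_add, e2] at c2'
  have f1 : -(M * t / 4) * (1 + t) + Fintype.card (Fin M) * ((t / 2 + (t / 2) ^ 2) / 2) =
      -(M * t ^ 2 / 8) := by simp; ring
  have f2 : -(-(M * t / 4)) * (1 - t) + Fintype.card (Fin M) * ((-(t / 2) + (-(t / 2)) ^ 2) / 2) =
      -(M * t ^ 2 / 8) := by simp; ring
  rw [f1] at c1'
  rw [f2] at c2'
  refine (measureReal_mono (fun L hL => ?_)).trans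
    ((measureReal_union_le _ _).trans ((add_le_add c1' c2').trans_eq (two_mul _).symm))
  simp only [Set.mem_union, Set.mem_ofPred_eq] at hL ⊢
  rcases lt_abs.1 hL with h | h
  · left; linarith
  · right; linarith

theorem exists_finset_half_net (E : Type*) [NormedAddCommGroup E] [NormedSpace ℝ E]
    [FiniteDimensional ℝ E] :
    ∃ N : Finset E, N.card ≤ 5 ^ Module.finrank ℝ E ∧ (∀ p ∈ N, ‖p‖ ≤ 1) ∧
      ∀ x : E, ‖x‖ ≤ 1 → ∃ p ∈ N, ‖x - p‖ ≤ 1 / 2 := by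
  classical
  let P : Finset E → Prop := fun s =>
    (∀ c ∈ s, ‖c‖ ≤ 2) ∧ ∀ c ∈ s, ∀ d ∈ s, c ≠ d → 1 ≤ ‖c - d‖
  have hbound (s : Finset E) (hs : P s) : s.card ≤ 5 ^ Module.finrank ℝ E :=
    Besicovitch.card_le_of_separated s hs.1 hs.2
  let Q : ℕ → Prop := fun k => ∃ s, P s ∧ s.card = k
  have hQ0 : Q 0 := ⟨∅, by simp [P], rfl⟩
  obtain ⟨s, hs, hcard⟩ : Q (Nat.findGreatest Q (5 ^ Module.finrank ℝ E)) :=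
    Nat.findGreatest_spec (Nat.zero_le _) hQ0
  have hmax (s' : Finset E) (hs' : P s') : s'.card ≤ s.card :=
    hcard ▸ Nat.le_findGreatest (hbound s' hs') ⟨s', hs', rfl⟩
  refine ⟨s.image fun c => (1 / 2 : ℝ) • c, Finset.card_image_le.trans (hbound s hs), ?_, ?_⟩
  · simp only [Finset.mem_image]
    rintro _ ⟨c, hc, rfl⟩
    rw [norm_smul]
    have := hs.1 c hc
    norm_num
    linarith
  · intro x hx
    obtain ⟨c, hc, hxc⟩ : ∃ c ∈ s, ‖(2 : ℝ) • x - c‖ ≤ 1 := by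
      by_contra! hcon
      have hnot : (2 : ℝ) • x ∉ s := fun h => by
        have := hcon _ h
        simp only [sub_self, norm_zero] at this
        linarith
      have hP : P (insert ((2 : ℝ) • x) s) := by
        refine ⟨?_, ?_⟩
        · intro c hc
          rcases Finset.mem_insert.1 hc with rfl | hc
          · rw [norm_smul]; norm_num; linarith
          · exact hs.1 c hc
        · intro c hc e he hce
          rcases Finset.mem_insert.1 hc with rfl | hc <;> rcases Finset.mem_insert.1 he with rfl | he
          · exact absurd rfl hce
          · exact (hcon e he).le
          · rw [norm_sub_rev]; exact (hcon c hc).le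
          · exact hs.2 c hc e he hce
      have := hmax _ hP
      rw [Finset.card_insert_of_notMem hnot] at this
      omega
    refine ⟨_, Finset.mem_image_of_mem _ hc, ?_⟩
    have : x - (1 / 2 : ℝ) • c = (1 / 2 : ℝ) • ((2 : ℝ) • x - c) := by
      rw [smul_sub, smul_smul]; norm_num
    rw [this, norm_smul]
    norm_num
    linarith

theorem opNorm_le_two_mul_of_half_net {E F : Type*} [NormedAddCommGroup E] [NormedSpace ℝ E]
    [NormedAddCommGroup F] [NormedSpace ℝ F] {N : Finset E}
    (hN : ∀ x : E, ‖x‖ ≤ 1 → ∃ p ∈ N, ‖x - p‖ ≤ 1 / 2) (f : E →L[ℝ] F) {c : ℝ}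
    (hf : ∀ p ∈ N, ‖f p‖ ≤ c) : ‖f‖ ≤ 2 * c := by
  have hc : 0 ≤ c := by
    obtain ⟨p, hp, -⟩ := hN 0 (by simp)
    exact (norm_nonneg _).trans (hf p hp)
  have h : ‖f‖ ≤ c + ‖f‖ * (1 / 2) := by
    refine f.opNorm_le_of_unit_norm (by positivity) fun x hx => ?_
    obtain ⟨p, hp, hxp⟩ := hN x hx.le
    calc ‖f x‖ = ‖f p + f (x - p)‖ := by rw [map_sub]; congr 1; abel
      _ ≤ ‖f p‖ + ‖f (x - p)‖ := norm_add_le _ _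
      _ ≤ c + ‖f‖ * (1 / 2) := by
        gcongr
        · exact hf p hp
        · exact (f.le_opNorm _).trans (by gcongr)
  linarith

theorem abs_norm_sq_sub_norm_sq_le_of_half_net {E F : Type*} [NormedAddCommGroup E]
    [InnerProductSpace ℝ E] [NormedAddCommGroup F] [InnerProductSpace ℝ F] {N : Finset E}
    (hN1 : ∀ p ∈ N, ‖p‖ ≤ 1) (hN : ∀ x : E, ‖x‖ ≤ 1 → ∃ p ∈ N, ‖x - p‖ ≤ 1 / 2)
    (S : E →L[ℝ] F) {t : ℝ} (ht : 0 ≤ t) (hS : ∀ p ∈ N, ∀ q ∈ N,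
      |‖S (p + q)‖ ^ 2 - ‖p + q‖ ^ 2| ≤ t * ‖p + q‖ ^ 2 ∧
      |‖S (p - q)‖ ^ 2 - ‖p - q‖ ^ 2| ≤ t * ‖p - q‖ ^ 2) (v : E) :
    |‖S v‖ ^ 2 - ‖v‖ ^ 2| ≤ 4 * t * ‖v‖ ^ 2 := by
  let B : E →L[ℝ] E →L[ℝ] ℝ := (innerSL ℝ).bilinearComp S S - innerSL ℝ
  have hB (x y : E) : B x y = inner ℝ (S x) (S y) - inner ℝ x y := rfl
  have hpq (p) (hp : p ∈ N) (q) (hq : q ∈ N) : ‖B p q‖ ≤ t := by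
    obtain ⟨ha, hs⟩ := hS p hp q hq
    rw [map_add, norm_add_sq_real, norm_add_sq_real] at ha
    rw [map_sub, norm_sub_sq_real, norm_sub_sq_real] at hs
    rw [hB, Real.norm_eq_abs]
    have hp2 : ‖p‖ ^ 2 ≤ 1 := pow_le_one₀ (norm_nonneg _) (hN1 p hp)
    have hq2 : ‖q‖ ^ 2 ≤ 1 := pow_le_one₀ (norm_nonneg _) (hN1 q hq)
    rw [abs_le] at *
    constructor <;> nlinarith
  have hBn : ‖B‖ ≤ 2 * (2 * t) := opNorm_le_two_mul_of_half_net hN B fun p hp =>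
    opNorm_le_two_mul_of_half_net hN (B p) fun q hq => hpq p hp q hq
  have h := B.le_opNorm₂ v v
  rw [hB, real_inner_self_eq_norm_sq, real_inner_self_eq_norm_sq, Real.norm_eq_abs] at h
  calc |‖S v‖ ^ 2 - ‖v‖ ^ 2| ≤ ‖B‖ * ‖v‖ * ‖v‖ := h
    _ ≤ 2 * (2 * t) * ‖v‖ * ‖v‖ := by gcongr
    _ = 4 * t * ‖v‖ ^ 2 := by ring

theorem exists_finset_test_vectors {H : Type*} [NormedAddCommGroup H] [InnerProductSpace ℝ H]
    (F : Type*) [NormedAddCommGroup F] [InnerProductSpace ℝ F]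
    (V : Submodule ℝ H) [FiniteDimensional ℝ V] :
    ∃ W : Finset H, W.card ≤ 2 * 25 ^ Module.finrank ℝ V ∧
      ∀ (T : H →ₗ[ℝ] F) (t : ℝ), 0 ≤ t →
        (∀ w ∈ W, |‖T w‖ ^ 2 - ‖w‖ ^ 2| ≤ t * ‖w‖ ^ 2) →
        ∀ v ∈ V, |‖T v‖ ^ 2 - ‖v‖ ^ 2| ≤ 4 * t * ‖v‖ ^ 2 := by
  classical
  obtain ⟨N, hcard, hN1, hN⟩ := exists_finset_half_net V
  refine ⟨(N ×ˢ N).image (fun p => ((p.1 + p.2 : V) : H)) ∪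
    (N ×ˢ N).image (fun p => ((p.1 - p.2 : V) : H)), ?_, ?_⟩
  · have h : (N ×ˢ N).card ≤ 25 ^ Module.finrank ℝ V := by
      rw [Finset.card_product]
      calc N.card * N.card ≤ 5 ^ Module.finrank ℝ V * 5 ^ Module.finrank ℝ V := by gcongr
        _ = 25 ^ Module.finrank ℝ V := by rw [← mul_pow]; norm_num
    refine (Finset.card_union_le _ _).trans ?_
    have h1 := (Finset.card_image_le (s := N ×ˢ N) (f := fun p => ((p.1 + p.2 : V) : H)))
    have h2 := (Finset.card_image_le (s := N ×ˢ N) (f := fun p => ((p.1 - p.2 : V) : H)))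
    omega
  · intro T t ht hT v hv
    refine abs_norm_sq_sub_norm_sq_le_of_half_net hN1 hN
      (T.comp V.subtype).toContinuousLinearMap ht (fun p hp q hq => ?_) ⟨v, hv⟩
    exact ⟨hT ((p + q : V) : H) (Finset.mem_union_left _ (Finset.mem_image.2
        ⟨(p, q), Finset.mk_mem_product hp hq, rfl⟩)),
      hT ((p - q : V) : H) (Finset.mem_union_right _ (Finset.mem_image.2
        ⟨(p, q), Finset.mk_mem_product hp hq, rfl⟩))⟩

open Classical in
theorem Finset.Shatters.card_le_finrank_of_nonneg_regions {ι E : Type*} [Fintype ι]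
    [AddCommGroup E] [Module ℝ E] [FiniteDimensional ℝ E] {h : ι → Module.Dual ℝ E}
    {𝒜 : Finset (Finset ι)} (h𝒜 : ∀ u ∈ 𝒜, ∃ x : E, {i | 0 ≤ h i x} = (u : Set ι))
    {s : Finset ι} (hs : 𝒜.Shatters s) : s.card ≤ Module.finrank ℝ E := by
  by_contra! hlt
  have hdep : ¬ LinearIndependent ℝ (fun i : s => h i) := fun hli => by
    have := hli.fintype_card_le_finrank
    rw [Fintype.card_coe, Subspace.dual_finrank_eq] at this
    omega
  obtain ⟨c, hc, i₀, hi₀⟩ : ∃ c : s → ℝ, ∑ i, c i • h i = 0 ∧ ∃ i, 0 < c i := by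
    obtain ⟨c, hc, i, hi⟩ := Fintype.not_linearIndependent_iff.1 hdep
    rcases hi.lt_or_gt with h0 | h0
    · exact ⟨-c, LinearMap.ext fun x => by simpa using LinearMap.congr_fun hc x, i, by simpa using h0⟩
    · exact ⟨c, hc, i, h0⟩
  obtain ⟨u, hu, hsu⟩ := hs (t := s.filter fun i => ∃ hi : i ∈ s, c ⟨i, hi⟩ ≤ 0)
    (Finset.filter_subset _ _)
  obtain ⟨x, hx⟩ := h𝒜 u hu
  have hsign (i : s) : 0 ≤ h i x ↔ c i ≤ 0 := by
    have h1 : (0 ≤ h i x) ↔ (i : ι) ∈ u := by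
      rw [← Finset.mem_coe, ← hx, Set.mem_ofPred_eq]
    have h2 := Finset.ext_iff.1 hsu i
    simp only [Finset.mem_inter, Finset.mem_filter, i.2, true_and, exists_true_left] at h2
    rw [h1, h2]
  have hle (i : s) : c i * h i x ≤ 0 := by
    rcases le_or_gt (c i) 0 with h0 | h0
    · exact mul_nonpos_of_nonpos_of_nonneg h0 ((hsign i).2 h0)
    · have := (hsign i).not.2 h0.not_ge
      exact mul_nonpos_of_nonneg_of_nonpos h0.le (not_le.1 this).le
  have hlt : c i₀ * h i₀ x < 0 :=
    mul_neg_of_pos_of_neg hi₀ (not_le.1 ((hsign i₀).not.2 hi₀.not_ge))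
  have hsum : ∑ i, c i * h i x = 0 := by
    have := LinearMap.congr_fun hc x
    simpa using this
  exact (Finset.sum_neg' (fun i _ => hle i) ⟨i₀, Finset.mem_univ _, hlt⟩).ne hsum

open Classical in
theorem card_nonneg_regions_le {ι E : Type*} [Fintype ι]
    [AddCommGroup E] [Module ℝ E] [FiniteDimensional ℝ E] (h : ι → Module.Dual ℝ E) :
    (Finset.univ.filter fun u : Finset ι => ∃ x : E, {i | 0 ≤ h i x} = (u : Set ι)).card ≤
      (Fintype.card ι + 1) ^ Module.finrank ℝ E := by
  set 𝒜 := Finset.univ.filter fun u : Finset ι => ∃ x : E, {i | 0 ≤ h i x} = (u : Set ι)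
  have hvc : 𝒜.vcDim ≤ Module.finrank ℝ E := Finset.sup_le fun s hs =>
    (Finset.mem_shatterer.1 hs).card_le_finrank_of_nonneg_regions (h := h) (by simp [𝒜])
  calc 𝒜.card ≤ ∑ k ∈ Finset.Iic 𝒜.vcDim, (Fintype.card ι).choose k :=
        (Finset.card_le_card_shatterer 𝒜).trans Finset.card_shatterer_le_sum_vcDim
    _ ≤ ∑ k ∈ Finset.Iic (Module.finrank ℝ E), (Fintype.card ι).choose k :=
        Finset.sum_le_sum_of_subset (Finset.Iic_subset_Iic.2 hvc)
    _ = ∑ k ∈ Finset.range (Module.finrank ℝ E + 1), (Fintype.card ι).choose k := by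
        rw [Nat.range_succ_eq_Iic]
    _ ≤ ∑ k ∈ Finset.range (Module.finrank ℝ E + 1),
          Fintype.card ι ^ k * 1 ^ (Module.finrank ℝ E - k) * (Module.finrank ℝ E).choose k := by
        refine Finset.sum_le_sum fun k hk => ?_
        rw [one_pow, mul_one]
        exact (Nat.choose_le_pow _ _).trans (Nat.le_mul_of_pos_right _
          (Nat.choose_pos (Nat.lt_succ_iff.1 (Finset.mem_range.1 hk))))
    _ = (Fintype.card ι + 1) ^ Module.finrank ℝ E := (add_pow _ _ _).symm

theorem sort_eq_of_le_iff_le {n : ℕ} {v w : Fin n → ℝ} (h : ∀ i j, v i ≤ v j ↔ w i ≤ w j) :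
    sortVec w = w ∘ Tuple.sort v := by
  refine (Tuple.comp_sort_eq_comp_iff_monotone.2 fun i j hij => ?_).symm
  exact (h _ _).1 (Tuple.monotone_sort v hij)

/-- The difference `⟨a_k, x_j⟩ - ⟨a_k, x_i⟩` as a linear functional of `X`. -/
noncomputable def rowComparison {n d D : ℕ} (A : Matrix (Fin d) (Fin D) ℝ)
    (p : Fin D × Fin n × Fin n) : Module.Dual ℝ (Matrix (Fin n) (Fin d) ℝ) where
  toFun X := X.mulVec (fun l => A l p.1) p.2.2 - X.mulVec (fun l => A l p.1) p.2.1
  map_add' X Y := by simp only [Matrix.add_mulVec, Pi.add_apply]; ring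
  map_smul' c X := by
    simp only [Matrix.smul_mulVec, Pi.smul_apply, smul_eq_mul, RingHom.id_apply]; ring

/-- The linear map that agrees with the flattened `betaEmb A` near a generic `X₀`. -/
noncomputable def linearBetaEmb {n d D : ℕ} (A : Matrix (Fin d) (Fin D) ℝ)
    (X₀ : Matrix (Fin n) (Fin d) ℝ) :
    Matrix (Fin n) (Fin d) ℝ →ₗ[ℝ] EuclideanSpace ℝ (Fin (n * D)) where
  toFun X := WithLp.toLp 2 (vecM (Matrix.of fun i k =>
    X.mulVec (fun l => A l k) (Tuple.sort (X₀.mulVec fun l => A l k) i)))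
  map_add' X Y := by ext; simp [vecM, Matrix.add_mulVec]
  map_smul' c X := by ext; simp [vecM, Matrix.smul_mulVec]

theorem linearBetaEmb_apply {n d D : ℕ} (A : Matrix (Fin d) (Fin D) ℝ)
    {X₀ X : Matrix (Fin n) (Fin d) ℝ}
    (h : {p | 0 ≤ rowComparison A p X₀} = {p | 0 ≤ rowComparison A p X}) :
    linearBetaEmb A X₀ X = WithLp.toLp 2 (vecM (betaEmb A X)) := by
  have hk (k : Fin D) : sortVec (X.mulVec fun l => A l k) =
      (X.mulVec fun l => A l k) ∘ Tuple.sort (X₀.mulVec fun l => A l k) :=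
    sort_eq_of_le_iff_le fun i j => by
      have := Set.ext_iff.1 h (k, i, j)
      simpa [rowComparison] using this
  simp only [linearBetaEmb, betaEmb, LinearMap.coe_mk, AddHom.coe_mk, hk, Function.comp_apply]

theorem norm_toLp_vecM {n D : ℕ} (B : Matrix (Fin n) (Fin D) ℝ) :
    ‖WithLp.toLp 2 (vecM B)‖ = frob B := by
  rw [EuclideanSpace.norm_eq, frob]
  congr 1
  simp only [Real.norm_eq_abs, sq_abs, vecM]
  rw [← Fintype.sum_prod_type', ← finProdFinEquiv.symm.sum_comp]

open Classical in
theorem exists_finset_test_vectors_betaEmb {n d D : ℕ} (A : Matrix (Fin d) (Fin D) ℝ)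
    (F : Type*) [NormedAddCommGroup F] [InnerProductSpace ℝ F] :
    ∃ W : Finset (EuclideanSpace ℝ (Fin (n * D))),
      W.card ≤ (D * n ^ 2 + 1) ^ (2 * (n * d)) * (2 * 25 ^ (2 * (n * d))) ∧
      ∀ (T : EuclideanSpace ℝ (Fin (n * D)) →ₗ[ℝ] F) (t : ℝ), 0 ≤ t →
        (∀ w ∈ W, |‖T w‖ ^ 2 - ‖w‖ ^ 2| ≤ t * ‖w‖ ^ 2) →
        ∀ X Y : Matrix (Fin n) (Fin d) ℝ,
          |‖T (WithLp.toLp 2 (vecM (betaEmb A X - betaEmb A Y)))‖ ^ 2 -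
            frob (betaEmb A X - betaEmb A Y) ^ 2| ≤
              4 * t * frob (betaEmb A X - betaEmb A Y) ^ 2 := by
  let 𝒜 := Finset.univ.filter fun u : Finset (Fin D × Fin n × Fin n) =>
    ∃ X : Matrix (Fin n) (Fin d) ℝ, {p | 0 ≤ rowComparison A p X} = (u : Set _)
  have h𝒜 : 𝒜.card ≤ (D * n ^ 2 + 1) ^ (n * d) := by
    have := card_nonneg_regions_le (rowComparison (n := n) A)
    simpa [Module.finrank_matrix, ← sq] using this
  let rep : Finset (Fin D × Fin n × Fin n) → Matrix (Fin n) (Fin d) ℝ := fun u =>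
    if hu : ∃ X : Matrix (Fin n) (Fin d) ℝ, {p | 0 ≤ rowComparison A p X} = (u : Set _)
      then hu.choose else 0
  let V : Finset (Fin D × Fin n × Fin n) × Finset (Fin D × Fin n × Fin n) →
      Submodule ℝ (EuclideanSpace ℝ (Fin (n * D))) := fun u =>
    LinearMap.range ((linearBetaEmb A (rep u.1)).coprod (-linearBetaEmb A (rep u.2)))
  have hV (u) : Module.finrank ℝ (V u) ≤ 2 * (n * d) := by
    refine (LinearMap.finrank_range_le _).trans_eq ?_
    simp [Module.finrank_matrix, two_mul]
  choose W hW hWT using fun u => exists_finset_test_vectors F (V u)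
  refine ⟨(𝒜 ×ˢ 𝒜).biUnion W, ?_, fun T t ht hT X Y => ?_⟩
  · calc ((𝒜 ×ˢ 𝒜).biUnion W).card ≤ (𝒜 ×ˢ 𝒜).card * (2 * 25 ^ (2 * (n * d))) :=
          Finset.card_biUnion_le_card_mul _ _ _ fun u _ => (hW u).trans (by
            gcongr
            · norm_num
            · exact hV u)
      _ ≤ (D * n ^ 2 + 1) ^ (2 * (n * d)) * (2 * 25 ^ (2 * (n * d))) := by
          rw [Finset.card_product, two_mul (n * d), pow_add (D * n ^ 2 + 1)]
          gcongr
  · let cell : Matrix (Fin n) (Fin d) ℝ → Finset (Fin D × Fin n × Fin n) := fun X =>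
      Finset.univ.filter fun p => 0 ≤ rowComparison A p X
    have hcell (X) : {p | 0 ≤ rowComparison A p X} = (cell X : Set _) := by ext; simp [cell]
    have hrep (X) : linearBetaEmb A (rep (cell X)) X = WithLp.toLp 2 (vecM (betaEmb A X)) := by
      have hex : ∃ Z : Matrix (Fin n) (Fin d) ℝ, {p | 0 ≤ rowComparison A p Z} =
        (cell X : Set _) := ⟨X, hcell X⟩
      refine linearBetaEmb_apply A ?_
      simp only [rep, dif_pos hex]
      rw [hex.choose_spec, hcell]
    have hmem : WithLp.toLp 2 (vecM (betaEmb A X - betaEmb A Y)) ∈ V (cell X, cell Y) := by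
      refine ⟨(X, Y), ?_⟩
      rw [LinearMap.coprod_apply, LinearMap.neg_apply, hrep, hrep, ← sub_eq_add_neg]
      rfl
    rw [← norm_toLp_vecM]
    refine hWT (cell X, cell Y) T t ht (fun w hw => hT w ?_) _ hmem
    have h𝒜cell (Z) : cell Z ∈ 𝒜 := Finset.mem_filter.2 ⟨Finset.mem_univ _, Z, hcell Z⟩
    exact Finset.mem_biUnion.2 ⟨(cell X, cell Y), Finset.mk_mem_product (h𝒜cell X) (h𝒜cell Y), hw⟩

theorem norm_toEuclideanLin_sq {M K : ℕ} (L : Matrix (Fin M) (Fin K) ℝ)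
    (w : EuclideanSpace ℝ (Fin K)) :
    ‖L.toEuclideanLin w‖ ^ 2 = ∑ i, (∑ j, L i j * w j) ^ 2 := by
  rw [EuclideanSpace.norm_sq_eq]
  simp [Matrix.toLpLin_apply, Matrix.mulVec, dotProduct]

open ProbabilityTheory in
theorem measureReal_distortion_gt_le {M K : ℕ} (hM : 0 < M) (w : EuclideanSpace ℝ (Fin K))
    {t : ℝ} (ht0 : 0 ≤ t) (ht1 : t ≤ 1) :
    (Measure.pi fun _ : Fin M => Measure.pi fun _ : Fin K =>
        gaussianReal 0 (1 / (M : NNReal))).real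
      {L | t * ‖w‖ ^ 2 < |‖(Matrix.of L).toEuclideanLin w‖ ^ 2 - ‖w‖ ^ 2|} ≤
        2 * Real.exp (-(M * t ^ 2 / 8)) := by
  rcases eq_or_ne w 0 with rfl | hw
  · simp only [map_zero, norm_zero, sub_self, abs_zero]
    norm_num
    positivity
  have hw0 : 0 < ‖w‖ := norm_pos_iff.2 hw
  have hu : ∑ j, (w j / ‖w‖) ^ 2 = 1 := by
    simp_rw [div_pow]
    rw [← Finset.sum_div, div_eq_one_iff_eq (by positivity), EuclideanSpace.norm_sq_eq]
    simp
  refine (measureReal_mono fun L hL => ?_).trans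
    (measureReal_abs_sum_sq_sub_one_gt_le hM hu ht0 ht1)
  simp only [Set.mem_ofPred_eq] at hL ⊢
  have h1 : ∑ i, (∑ j, L i j * (w j / ‖w‖)) ^ 2 =
      ‖(Matrix.of L).toEuclideanLin w‖ ^ 2 / ‖w‖ ^ 2 := by
    simp_rw [norm_toEuclideanLin_sq, mul_div_assoc', ← Finset.sum_div, div_pow, Matrix.of_apply]
    rw [Finset.sum_div]
  have h2 : ‖(Matrix.of L).toEuclideanLin w‖ ^ 2 / ‖w‖ ^ 2 - 1 =
      (‖(Matrix.of L).toEuclideanLin w‖ ^ 2 - ‖w‖ ^ 2) / ‖w‖ ^ 2 := by field_simp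
  rw [h1, h2, abs_div, abs_of_pos (pow_pos hw0 2), lt_div_iff₀ (by positivity)]
  exact hL

theorem card_mul_exp_le {ε η : ℝ} (hε : ε ∈ Set.Ioo (0 : ℝ) 1) (hη : η ∈ Set.Ioo (0 : ℝ) 1)
    {n d D : ℕ} (hn : 2 ≤ n) (hd : 2 ≤ d) (hD : 2 ≤ D) {M : ℕ}
    (hM : (M : ℝ) ≥ 1152 * ε⁻¹ ^ 2 *
      (n * d * Real.log (1 / ε) + Real.log (1 / η) + n * d * Real.log (D * n ^ 2))) :
    0 < M ∧ ((D * n ^ 2 + 1) ^ (2 * (n * d)) * (2 * 25 ^ (2 * (n * d))) : ℝ) *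
      (2 * Real.exp (-(M * (ε / 4) ^ 2 / 8))) ≤ η := by
  obtain ⟨hε0, hε1⟩ := hε
  obtain ⟨hη0, hη1⟩ := hη
  have hn' : (2 : ℝ) ≤ n := by exact_mod_cast hn
  have hd' : (2 : ℝ) ≤ d := by exact_mod_cast hd
  have hD' : (2 : ℝ) ≤ D := by exact_mod_cast hD
  set q : ℝ := D * n ^ 2 with hq
  have hq8 : 8 ≤ q := by
    have : (2 : ℝ) ^ 2 ≤ n ^ 2 := by gcongr
    nlinarith
  have hlogε : 0 ≤ Real.log (1 / ε) := Real.log_nonneg (by rw [le_div_iff₀ hε0]; linarith)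
  have hlogη : 0 ≤ Real.log (1 / η) := Real.log_nonneg (by rw [le_div_iff₀ hη0]; linarith)
  have hlogq : 0 < Real.log q := Real.log_pos (by linarith)
  have hqexp : Real.exp (Real.log q) = q := Real.exp_log (by linarith)
  have hN : (1 : ℝ) ≤ n * d := by nlinarith
  have hpos : 0 < n * d * Real.log (1 / ε) + Real.log (1 / η) + n * d * Real.log q := by
    positivity
  have hM0 : (0 : ℝ) < M := lt_of_lt_of_le (by positivity) hM
  refine ⟨by exact_mod_cast hM0, ?_⟩
  have hMε : 1152 * (n * d * Real.log (1 / ε) + Real.log (1 / η) + n * d * Real.log q) ≤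
      M * ε ^ 2 := by
    have := mul_le_mul_of_nonneg_right hM (sq_nonneg ε)
    refine le_trans (le_of_eq ?_) this
    field_simp
  have hsq : q ^ 2 = Real.exp (2 * Real.log q) := by
    rw [← hqexp, ← Real.exp_nat_mul, Real.log_exp]; norm_num
  have h1 : q + 1 ≤ Real.exp (2 * Real.log q) := by rw [← hsq]; nlinarith
  have h2 : (25 : ℝ) ≤ Real.exp (2 * Real.log q) := by rw [← hsq]; nlinarith
  have h3 : (4 : ℝ) ≤ Real.exp (n * d * Real.log q) := by
    refine le_trans (by linarith [hqexp] : (4 : ℝ) ≤ Real.exp (Real.log q)) ?_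
    rw [Real.exp_le_exp]
    nlinarith
  calc ((q + 1) ^ (2 * (n * d)) * (2 * 25 ^ (2 * (n * d))) : ℝ) *
      (2 * Real.exp (-(M * (ε / 4) ^ 2 / 8)))
      = (q + 1) ^ (2 * (n * d)) * 25 ^ (2 * (n * d)) * 4 *
          Real.exp (-(M * (ε / 4) ^ 2 / 8)) := by ring
    _ ≤ Real.exp (2 * Real.log q) ^ (2 * (n * d)) * Real.exp (2 * Real.log q) ^ (2 * (n * d)) *
          Real.exp (n * d * Real.log q) * Real.exp (-(M * (ε / 4) ^ 2 / 8)) := by gcongr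
    _ = Real.exp (9 * (n * d * Real.log q) - M * ε ^ 2 / 128) := by
        rw [← Real.exp_nat_mul, ← Real.exp_add, ← Real.exp_add, ← Real.exp_add]
        congr 1
        push_cast
        ring
    _ ≤ Real.exp (-Real.log (1 / η)) := by
        rw [Real.exp_le_exp]
        have : 0 ≤ n * d * Real.log (1 / ε) := by positivity
        linarith
    _ = η := by rw [one_div, Real.log_inv, neg_neg, Real.exp_log hη0]

theorem mul_le_and_le_mul_of_abs_sq_sub_sq_le {a b ε : ℝ} (ha : 0 ≤ a) (hb : 0 ≤ b)
    (hε : ε ∈ Set.Ioo (0 : ℝ) 1) (h : |a ^ 2 - b ^ 2| ≤ ε * b ^ 2) :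
    (1 - ε) * b ≤ a ∧ a ≤ (1 + ε) * b := by
  obtain ⟨h1, h2⟩ := abs_le.1 h
  obtain ⟨hε0, hε1⟩ := hε
  have hb2 := sq_nonneg b
  have he : 0 ≤ ε * (1 - ε) * b ^ 2 := by
    have : 0 ≤ 1 - ε := by linarith
    positivity
  constructor
  · refine (pow_le_pow_iff_left₀ (mul_nonneg (by linarith) hb) ha two_ne_zero).1 ?_
    nlinarith
  · refine (pow_le_pow_iff_left₀ ha (by positivity) two_ne_zero).1 ?_
    nlinarith [mul_nonneg hε0.le hb2, mul_nonneg (sq_nonneg ε) hb2]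

/-- Sketching preserves the bi-Lipschitz bounds of `β_A`: there is an absolute constant
`C > 0` such that for `M ≥ C·ε⁻²·(nd·log(1/ε) + log(1/η) + nd·log(Dn²))`, a random
`M × nD` matrix `L` with i.i.d. `N(0, 1/M)` entries satisfies, with probability at least
`1 - η`, `(1-ε)·C₁·dist(X,Y) ≤ ‖L·vec(β_A X) - L·vec(β_A Y)‖₂ ≤ (1+ε)·C₂·dist(X,Y)`
for all `X, Y`, whenever `β_A` is bi-Lipschitz with constants `C₁, C₂`. -/
theorem stmt17 : ∃ C : ℝ, 0 < C ∧
    ∀ (ε η : ℝ), ε ∈ Set.Ioo (0 : ℝ) 1 → η ∈ Set.Ioo (0 : ℝ) 1 →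
    ∀ (n d D : ℕ), 2 ≤ n → 2 ≤ d → 2 ≤ D →
    ∀ (A : Matrix (Fin d) (Fin D) ℝ) (C₁ C₂ : ℝ), 0 < C₁ →
    (∀ X Y : Matrix (Fin n) (Fin d) ℝ,
      C₁ * permDist X Y ≤ frob (betaEmb A X - betaEmb A Y) ∧
      frob (betaEmb A X - betaEmb A Y) ≤ C₂ * permDist X Y) →
    ∀ M : ℕ, (M : ℝ) ≥ C * ε⁻¹ ^ 2 *
        (n * d * Real.log (1 / ε) + Real.log (1 / η) + n * d * Real.log (D * n ^ 2)) →
    (Measure.pi fun _ : Fin M => Measure.pi fun _ : Fin (n * D) =>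
        ProbabilityTheory.gaussianReal 0 (1 / (M : NNReal)))
      {L : Fin M → Fin (n * D) → ℝ | ∀ X Y : Matrix (Fin n) (Fin d) ℝ,
        (1 - ε) * C₁ * permDist X Y ≤
          Real.sqrt (∑ i, ((Matrix.of L).mulVec (vecM (betaEmb A X)) i -
            (Matrix.of L).mulVec (vecM (betaEmb A Y)) i) ^ 2) ∧
        Real.sqrt (∑ i, ((Matrix.of L).mulVec (vecM (betaEmb A X)) i -
            (Matrix.of L).mulVec (vecM (betaEmb A Y)) i) ^ 2) ≤
          (1 + ε) * C₂ * permDist X Y} ≥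
      ENNReal.ofReal (1 - η) := by
  refine ⟨1152, by norm_num, ?_⟩
  intro ε η hε hη n d D hn hd hD A C₁ C₂ hC₁ hLip M hM
  obtain ⟨hM0, hcard⟩ := card_mul_exp_le hε hη hn hd hD hM
  obtain ⟨W, hW, hWT⟩ := exists_finset_test_vectors_betaEmb (n := n) A (EuclideanSpace ℝ (Fin M))
  set μ := Measure.pi fun _ : Fin M => Measure.pi fun _ : Fin (n * D) =>
    ProbabilityTheory.gaussianReal 0 (1 / (M : NNReal))
  set G := {L : Fin M → Fin (n * D) → ℝ | ∀ X Y : Matrix (Fin n) (Fin d) ℝ, _}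
  let bad : EuclideanSpace ℝ (Fin (n * D)) → Set (Fin M → Fin (n * D) → ℝ) := fun w =>
    {L | ε / 4 * ‖w‖ ^ 2 < |‖(Matrix.of L).toEuclideanLin w‖ ^ 2 - ‖w‖ ^ 2|}
  have hbad : μ.real (⋃ w ∈ W, bad w) ≤ η := by
    refine (measureReal_biUnion_finset_le W bad).trans ?_
    refine (Finset.sum_le_sum fun w _ => measureReal_distortion_gt_le hM0 w
      (by linarith [hε.1]) (by linarith [hε.2])).trans (le_trans ?_ hcard)
    rw [Finset.sum_const, nsmul_eq_mul]
    gcongr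
    exact_mod_cast hW
  have hcover : Set.univ ⊆ G ∪ ⋃ w ∈ W, bad w := by
    intro L _
    by_cases hL : L ∈ ⋃ w ∈ W, bad w
    · exact Or.inr hL
    refine Or.inl fun X Y => ?_
    simp only [Set.mem_iUnion, not_exists] at hL
    have h := hWT (Matrix.of L).toEuclideanLin (ε / 4) (by linarith [hε.1])
      (fun w hw => not_lt.1 (hL w hw)) X Y
    rw [mul_div_cancel₀ ε four_ne_zero] at h
    obtain ⟨hlo, hup⟩ := mul_le_and_le_mul_of_abs_sq_sub_sq_le (norm_nonneg _)
      (Real.sqrt_nonneg _) hε h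
    have hnorm : ‖(Matrix.of L).toEuclideanLin
        (WithLp.toLp 2 (vecM (betaEmb A X - betaEmb A Y)))‖ =
        Real.sqrt (∑ i, ((Matrix.of L).mulVec (vecM (betaEmb A X)) i -
            (Matrix.of L).mulVec (vecM (betaEmb A Y)) i) ^ 2) := by
      have hsub : vecM (betaEmb A X - betaEmb A Y) =
        vecM (betaEmb A X) - vecM (betaEmb A Y) := rfl
      rw [hsub, EuclideanSpace.norm_eq]
      simp [Matrix.toLpLin_apply, Matrix.mulVec_sub]
    rw [← hnorm]
    obtain ⟨h1, h2⟩ := hLip X Y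
    have hε0 : 0 ≤ 1 - ε := by linarith [hε.2]
    have hε1 : 0 ≤ 1 + ε := by linarith [hε.1]
    constructor
    · rw [mul_assoc]
      exact (mul_le_mul_of_nonneg_left h1 hε0).trans hlo
    · rw [mul_assoc]
      exact hup.trans (mul_le_mul_of_nonneg_left h2 hε1)
  have hone : 1 ≤ μ.real G + μ.real (⋃ w ∈ W, bad w) := by
    rw [← probReal_univ (μ := μ)]
    exact (measureReal_mono hcover).trans (measureReal_union_le _ _)
  rw [ge_iff_le, ENNReal.ofReal_le_iff_le_toReal (measure_ne_top _ _)]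
  change 1 - η ≤ μ.real G
  linarith
end
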